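/- Let m ≥ 1, n₁,…,n_m ≥ 1, 1 < p < q < ∞, 0 < β_i < n_i, and 1/q = 1/p - β_i/n_i for each i. Define on the product space ℝ^{n₁}×⋯×ℝ^{n_m} the operator 𝓗_{β₁,…,β_m}(f)(x) = ∏_{i=1}^m |B(0,|x_i|)|^{-(1-β_i/n_i)} ∫_{|y₁|<|x₁|}⋯∫_{|y_m|<|x_m|} f(y₁,…,y_m) dy₁⋯dy_m. Then for f ∈ L^p(ℝ^{n₁}×⋯×ℝ^{n_m}), ‖𝓗_{β₁,…,β_m}(f)‖_{L^q} ≤ C ‖f‖_{L^p} with C = ∏_{i=1}^m (p'/q)^{1/q} ((n_i/(qβ_i)) B(n_i/(qβ_i), n_i/(q'β_i)))^{-β_i/n_i}, and moreover the operator norm of 𝓗_{β₁,…,β_m} from L^p to L^q equals C. -/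

import Mathlib

open MeasureTheory Set
open scoped ENNReal

/-- The Euler Beta function `B(z,w) = ∫₀¹ t^(z-1) (1-t)^(w-1) dt`. -/
noncomputable def betaFn (z w : ℝ) : ℝ :=
  ∫ t in Ioo (0 : ℝ) 1, t ^ (z - 1) * (1 - t) ^ (w - 1)

/-- The fractional Hardy operator `𝓗_{β₁,…,β_m}` on the product space
`ℝ^{n₁} × ⋯ × ℝ^{n_m}`. -/
noncomputable def prodFracHardy (m : ℕ) (n : Fin m → ℕ) (β : Fin m → ℝ)
    (f : (∀ i, EuclideanSpace ℝ (Fin (n i))) → ℝ≥0∞)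
    (x : ∀ i, EuclideanSpace ℝ (Fin (n i))) : ℝ≥0∞ :=
  (∏ i, (volume (Metric.ball (0 : EuclideanSpace ℝ (Fin (n i))) ‖x i‖)) ^
      (β i / (n i : ℝ) - 1)) *
    ∫⁻ y in {y : ∀ i, EuclideanSpace ℝ (Fin (n i)) | ∀ i, ‖y i‖ < ‖x i‖}, f y

theorem ENNReal.rpow_one_div_le_iff {x y : ℝ≥0∞} {z : ℝ} (hz : 0 < z) :
    x ^ (1 / z) ≤ y ↔ x ≤ y ^ z := by
  rw [one_div, ENNReal.rpow_inv_le_iff hz]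

/-- The converse of Hölder's inequality for nonnegative functions. -/
theorem lintegral_rpow_le_of_forall_lintegral_mul_le {α : Type*} [MeasurableSpace α]
    (μ : Measure α) [SigmaFinite μ] {s s' : ℝ} (hs : s.HolderConjugate s') {φ : α → ℝ≥0∞}
    (hφ : Measurable φ) (C : ℝ≥0∞)
    (h : ∀ ψ : α → ℝ≥0∞, Measurable ψ →
      ∫⁻ x, φ x * ψ x ∂μ ≤ C * (∫⁻ x, ψ x ^ s' ∂μ) ^ (1 / s')) :
    (∫⁻ x, φ x ^ s ∂μ) ^ (1 / s) ≤ C := by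
  have hs0 : 0 < s := hs.pos
  have hs'0 : 0 < s' := hs.symm.pos
  have hs1 : 1 < s := hs.lt
  rw [ENNReal.rpow_one_div_le_iff hs0]
  let S := spanningSets μ
  let F : ℕ → α → ℝ≥0∞ := fun N => (S N).indicator fun x => min (φ x) N
  have hF : ∀ N, Measurable (F N) := fun N =>
    (hφ.min measurable_const).indicator (measurableSet_spanningSets μ N)
  have hFφ : ∀ N x, F N x ≤ φ x := fun N x =>
    (indicator_le_self' (fun _ _ => zero_le) x).trans (min_le_left _ _)
  have key : ∀ N, ∫⁻ x, F N x ^ s ∂μ ≤ C ^ s := by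
    intro N
    set A := ∫⁻ x, F N x ^ s ∂μ with hA
    have hAtop : A ≠ ⊤ := by
      have h1 : A ≤ ∫⁻ x, (S N).indicator (fun _ => (N : ℝ≥0∞) ^ s) x ∂μ := by
        refine lintegral_mono fun x => ?_
        by_cases hx : x ∈ S N
        · simp only [F, indicator_of_mem hx]
          exact ENNReal.rpow_le_rpow (min_le_right _ _) hs0.le
        · simp [F, indicator_of_notMem hx, hs0]
      rw [lintegral_indicator_const (measurableSet_spanningSets μ N)] at h1
      refine ne_top_of_le_ne_top (ENNReal.mul_ne_top ?_ (measure_spanningSets_lt_top μ N).ne) h1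
      exact ENNReal.rpow_ne_top_of_nonneg hs0.le (ENNReal.natCast_ne_top N)
    have h2 : A ≤ C * A ^ (1 / s') := by
      have h3 := h (fun x => F N x ^ (s - 1)) ((hF N).pow_const _)
      have h4 : ∀ x, (F N x ^ (s - 1)) ^ s' = F N x ^ s := fun x => by
        rw [← ENNReal.rpow_mul, hs.sub_one_mul_conj]
      simp only [h4] at h3
      refine le_trans (lintegral_mono fun x => ?_) h3
      calc F N x ^ s = F N x ^ (1 + (s - 1)) := by ring_nf
        _ = F N x * F N x ^ (s - 1) := by
            rw [ENNReal.rpow_add_of_nonneg _ _ zero_le_one (by linarith), ENNReal.rpow_one]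
        _ ≤ φ x * F N x ^ (s - 1) := by gcongr; exact hFφ N x
    by_cases hA0 : A = 0
    · rw [hA0]; exact zero_le
    · have h5 : A = A ^ (1 / s) * A ^ (1 / s') := by
        rw [← ENNReal.rpow_add _ _ hA0 hAtop, hs.one_div_add_one_div, div_one, ENNReal.rpow_one]
      have h6 : A ^ (1 / s) * A ^ (1 / s') ≤ C * A ^ (1 / s') := by rw [← h5]; exact h2
      have h7 : A ^ (1 / s') ≠ 0 := by
        simp [ENNReal.rpow_eq_zero_iff, hA0, hAtop]
      have h8 : A ^ (1 / s') ≠ ⊤ := ENNReal.rpow_ne_top_of_nonneg (by positivity) hAtop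
      rw [← ENNReal.rpow_one_div_le_iff hs0]
      exact (ENNReal.mul_le_mul_iff_left h7 h8).1 h6
  have hlim : Filter.Tendsto (fun N => ∫⁻ x, F N x ^ s ∂μ) Filter.atTop
      (nhds (∫⁻ x, φ x ^ s ∂μ)) := by
    refine lintegral_tendsto_of_tendsto_of_monotone (fun N => ((hF N).pow_const s).aemeasurable)
      (.of_forall fun x N M hNM => ?_) (.of_forall fun x => ?_)
    · refine ENNReal.rpow_le_rpow ?_ hs0.le
      by_cases hx : x ∈ S N
      · have hx' : x ∈ S M := monotone_spanningSets μ hNM hx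
        simp only [F, indicator_of_mem hx, indicator_of_mem hx']
        exact min_le_min_left _ (Nat.cast_le.2 hNM)
      · simp [F, indicator_of_notMem hx]
    · refine ((ENNReal.continuous_rpow_const).tendsto _).comp ?_
      have h9 : Filter.Tendsto (fun N : ℕ => min (φ x) (N : ℝ≥0∞)) Filter.atTop
          (nhds (min (φ x) ⊤)) :=
        tendsto_const_nhds.min ENNReal.tendsto_nat_nhds_top
      rw [min_eq_left le_top] at h9
      refine h9.congr' ?_
      filter_upwards [Filter.eventually_ge_atTop (spanningSetsIndex μ x)] with N hN
      exact (indicator_of_mem (monotone_spanningSets μ hN (mem_spanningSetsIndex μ x))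
        fun x => min (φ x) (N : ℝ≥0∞)).symm
  exact le_of_tendsto' hlim key

/-- Minkowski's integral inequality. -/
theorem lintegral_rpow_lintegral_le {α β : Type*} [MeasurableSpace α] [MeasurableSpace β]
    (μ : Measure α) [SigmaFinite μ] (ν : Measure β) [SFinite ν] {s : ℝ} (hs : 1 < s)
    {H : α → β → ℝ≥0∞} (hH : Measurable (Function.uncurry H)) :
    (∫⁻ x, (∫⁻ y, H x y ∂ν) ^ s ∂μ) ^ (1 / s) ≤ ∫⁻ y, (∫⁻ x, H x y ^ s ∂μ) ^ (1 / s) ∂ν := by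
  have hc := Real.HolderConjugate.conjExponent hs
  refine lintegral_rpow_le_of_forall_lintegral_mul_le μ hc hH.lintegral_prod_right' _
    fun ψ hψ => ?_
  have hHψ : Measurable (Function.uncurry fun x y => H x y * ψ x) :=
    hH.mul (hψ.comp measurable_fst)
  calc ∫⁻ x, (∫⁻ y, H x y ∂ν) * ψ x ∂μ = ∫⁻ x, ∫⁻ y, H x y * ψ x ∂ν ∂μ := by
        refine lintegral_congr fun x => ?_
        exact (lintegral_mul_const _ (hH.comp measurable_prodMk_left)).symm
    _ = ∫⁻ y, ∫⁻ x, H x y * ψ x ∂μ ∂ν := lintegral_lintegral_swap hHψ.aemeasurable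
    _ ≤ ∫⁻ y, (∫⁻ x, H x y ^ s ∂μ) ^ (1 / s) *
          (∫⁻ x, ψ x ^ s.conjExponent ∂μ) ^ (1 / s.conjExponent) ∂ν :=
        lintegral_mono fun y => ENNReal.lintegral_mul_le_Lp_mul_Lq μ hc
          (hH.comp measurable_prodMk_right).aemeasurable hψ.aemeasurable
    _ = _ := lintegral_mul_const _
        ((hH.pow_const s).lintegral_prod_left'.pow_const _)

/-- A positive integral operator on a product of two spaces whose kernel is a product of kernels
of bounded operators from `L^p` to `L^q` is bounded by the product of the bounds. -/
theorem lintegral_prod_kernel_le {α β : Type*} [MeasurableSpace α] [MeasurableSpace β]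
    (μ : Measure α) [SigmaFinite μ] (ν : Measure β) [SigmaFinite ν] {p q : ℝ} (hp : 0 < p)
    (hpq : p < q) {k : α → α → ℝ≥0∞} {l : β → β → ℝ≥0∞} (hk : Measurable (Function.uncurry k))
    (hl : Measurable (Function.uncurry l)) {c d : ℝ≥0∞}
    (hkc : ∀ f : α → ℝ≥0∞, Measurable f →
      (∫⁻ x, (∫⁻ y, k x y * f y ∂μ) ^ q ∂μ) ^ (1 / q) ≤ c * (∫⁻ x, f x ^ p ∂μ) ^ (1 / p))
    (hld : ∀ f : β → ℝ≥0∞, Measurable f →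
      (∫⁻ x, (∫⁻ y, l x y * f y ∂ν) ^ q ∂ν) ^ (1 / q) ≤ d * (∫⁻ x, f x ^ p ∂ν) ^ (1 / p))
    {f : α × β → ℝ≥0∞} (hf : Measurable f) :
    (∫⁻ x, (∫⁻ y, k x.1 y.1 * l x.2 y.2 * f y ∂μ.prod ν) ^ q ∂μ.prod ν) ^ (1 / q) ≤
      c * d * (∫⁻ x, f x ^ p ∂μ.prod ν) ^ (1 / p) := by
  have hq : 0 < q := hp.trans hpq
  let G : α → β → ℝ≥0∞ := fun x' y => ∫⁻ y', l y y' * f (x', y') ∂ν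
  have hG : Measurable (Function.uncurry G) := by
    have : Measurable fun z : (α × β) × β => l z.1.2 z.2 * f (z.1.1, z.2) := by fun_prop
    exact this.lintegral_prod_right'
  have hin : ∀ x y, ∫⁻ z, k x z.1 * l y z.2 * f z ∂μ.prod ν = ∫⁻ x', k x x' * G x' y ∂μ := by
    intro x y
    rw [lintegral_prod _ (by fun_prop)]
    refine lintegral_congr fun x' => ?_
    rw [← lintegral_const_mul _ (by fun_prop)]
    simp only [mul_assoc]
  have hkG : Measurable fun z : α × β => ∫⁻ x', k z.1 x' * G x' z.2 ∂μ := by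
    have : Measurable fun z : (α × β) × α => k z.1.1 z.2 * G z.2 z.1.2 := by fun_prop
    exact this.lintegral_prod_right'
  have h1 : ∀ y, ∫⁻ x, (∫⁻ x', k x x' * G x' y ∂μ) ^ q ∂μ ≤
      c ^ q * (∫⁻ x', G x' y ^ p ∂μ) ^ (q / p) := by
    intro y
    have := hkc (fun x' => G x' y) (by fun_prop)
    rw [ENNReal.rpow_one_div_le_iff hq, ENNReal.mul_rpow_of_nonneg _ _ hq.le,
      ← ENNReal.rpow_mul] at this
    rwa [show 1 / p * q = q / p by ring] at this
  have h2 : ∀ x', (∫⁻ y, (G x' y ^ p) ^ (q / p) ∂ν) ^ (1 / (q / p)) ≤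
      d ^ p * ∫⁻ y, f (x', y) ^ p ∂ν := by
    intro x'
    have := ENNReal.rpow_le_rpow (hld (fun y => f (x', y)) (by fun_prop)) hp.le
    rw [ENNReal.mul_rpow_of_nonneg _ _ hp.le, ← ENNReal.rpow_mul, ← ENNReal.rpow_mul,
      one_div_mul_cancel hp.ne', ENNReal.rpow_one] at this
    simp only [← ENNReal.rpow_mul, mul_div_cancel₀ q hp.ne']
    rwa [show 1 / (q / p) = 1 / q * p by field_simp]
  have hmk := lintegral_rpow_lintegral_le ν μ (s := q / p) (by rwa [one_lt_div hp])
    (H := fun y x' => G x' y ^ p) (by simp only [Function.uncurry_def]; fun_prop)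
  rw [ENNReal.rpow_one_div_le_iff hq]
  calc ∫⁻ x, (∫⁻ y, k x.1 y.1 * l x.2 y.2 * f y ∂μ.prod ν) ^ q ∂μ.prod ν
      = ∫⁻ y, ∫⁻ x, (∫⁻ x', k x x' * G x' y ∂μ) ^ q ∂μ ∂ν := by
        simp only [hin]
        rw [lintegral_prod_symm _ (hkG.pow_const q).aemeasurable]
    _ ≤ ∫⁻ y, c ^ q * (∫⁻ x', G x' y ^ p ∂μ) ^ (q / p) ∂ν := lintegral_mono h1
    _ = c ^ q * ∫⁻ y, (∫⁻ x', G x' y ^ p ∂μ) ^ (q / p) ∂ν :=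
        lintegral_const_mul _ ((hG.pow_const p).lintegral_prod_left'.pow_const _)
    _ ≤ c ^ q * (∫⁻ x', d ^ p * ∫⁻ y, f (x', y) ^ p ∂ν ∂μ) ^ (q / p) := by
        gcongr
        rw [← ENNReal.rpow_one_div_le_iff (by positivity)]
        exact hmk.trans (lintegral_mono h2)
    _ = c ^ q * (d ^ p * ∫⁻ x, f x ^ p ∂μ.prod ν) ^ (q / p) := by
        rw [lintegral_const_mul _ (hf.pow_const p).lintegral_prod_right',
          lintegral_prod _ (hf.pow_const p).aemeasurable]
    _ = (c * d * (∫⁻ x, f x ^ p ∂μ.prod ν) ^ (1 / p)) ^ q := by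
        rw [ENNReal.mul_rpow_of_nonneg _ _ (by positivity), ENNReal.mul_rpow_of_nonneg _ _ hq.le,
          ENNReal.mul_rpow_of_nonneg _ _ hq.le, ← ENNReal.rpow_mul, ← ENNReal.rpow_mul,
          mul_div_cancel₀ q hp.ne', show 1 / p * q = q / p by ring, mul_assoc]

/-- A positive integral operator on a finite product of spaces whose kernel is a product of kernels
of bounded operators from `L^p` to `L^q` is bounded by the product of the bounds. -/
theorem lintegral_pi_kernel_le {p q : ℝ} (hp : 0 < p) (hpq : p < q) : ∀ {m : ℕ}
    {X : Fin m → Type*} [∀ i, MeasurableSpace (X i)] (μ : ∀ i, Measure (X i))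
    [∀ i, SigmaFinite (μ i)] {k : ∀ i, X i → X i → ℝ≥0∞}
    (_ : ∀ i, Measurable (Function.uncurry (k i))) {c : Fin m → ℝ≥0∞}
    (_ : ∀ i, ∀ f : X i → ℝ≥0∞, Measurable f →
      (∫⁻ x, (∫⁻ y, k i x y * f y ∂μ i) ^ q ∂μ i) ^ (1 / q) ≤
        c i * (∫⁻ x, f x ^ p ∂μ i) ^ (1 / p))
    {f : (∀ i, X i) → ℝ≥0∞} (_ : Measurable f),
    (∫⁻ x, (∫⁻ y, (∏ i, k i (x i) (y i)) * f y ∂Measure.pi μ) ^ q ∂Measure.pi μ) ^ (1 / q) ≤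
      (∏ i, c i) * (∫⁻ x, f x ^ p ∂Measure.pi μ) ^ (1 / p) := by
  intro m
  induction m with
  | zero =>
    intro X _ μ _ k hk c h f hf
    have hq := hp.trans hpq
    simp only [Measure.pi_of_empty μ, lintegral_dirac, Finset.univ_eq_empty, Finset.prod_empty,
      one_mul, ← ENNReal.rpow_mul, mul_one_div_cancel hp.ne', mul_one_div_cancel hq.ne', le_refl]
  | succ m ih =>
    intro X _ μ _ k hk c h f hf
    let e := MeasurableEquiv.piFinSuccAbove X 0
    have he := measurePreserving_piFinSuccAbove μ 0
    have hmain := lintegral_prod_kernel_le (μ 0) (Measure.pi fun j : Fin m => μ j.succ) hp hpq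
      (hk 0) (l := fun x y => ∏ j : Fin m, k j.succ (x j) (y j))
      (by
        simp only [Function.uncurry_def]
        refine Finset.measurable_prod _ fun j _ => ?_
        exact (hk j.succ).comp (g := Function.uncurry (k j.succ))
          (f := fun z : (∀ j : Fin m, X j.succ) × (∀ j : Fin m, X j.succ) => (z.1 j, z.2 j))
          (by fun_prop))
      (h 0) (fun f hf => ih (fun j : Fin m => μ j.succ) (fun j => hk j.succ)
        (fun j => h j.succ) hf) (hf.comp e.symm.measurable)
    have hpull : ∀ g : (∀ i, X i) → ℝ≥0∞,
        ∫⁻ z, g (e.symm z) ∂((μ 0).prod (Measure.pi fun j : Fin m => μ j.succ)) =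
          ∫⁻ x, g x ∂Measure.pi μ := by
      intro g
      exact (he.symm e).lintegral_comp_emb e.symm.measurableEmbedding g
    have h1 : ∀ z : X 0 × (∀ j : Fin m, X j.succ), e.symm z 0 = z.1 := fun z => rfl
    have h2 : ∀ (z : X 0 × (∀ j : Fin m, X j.succ)) (j : Fin m), e.symm z j.succ = z.2 j :=
      fun z j => rfl
    rw [← hpull, ← hpull (fun x => f x ^ p)]
    simp only [← hpull (fun y => _ * f y), Fin.prod_univ_succ, h1, h2]
    exact hmain

/-- The `q`-energy density of the extremal function of Bliss' inequality. -/
noncomputable def blissDensity (r q t : ℝ) : ℝ := t ^ r * (1 + t ^ r) ^ (-(q / r))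

theorem continuous_one_add_rpow_rpow {r : ℝ} (hr : 0 < r) (s : ℝ) :
    ContinuousOn (fun t : ℝ => (1 + t ^ r) ^ s) (Ici 0) := by
  intro t ht
  have h1 : 0 ≤ t ^ r := Real.rpow_nonneg ht r
  have h2 : ContinuousAt (fun t : ℝ => t ^ r) t := Real.continuousAt_rpow_const _ _ (.inr hr.le)
  have h3 : 1 + t ^ r ≠ 0 := by positivity
  exact ((continuousAt_const.add h2).rpow_const (.inl h3)).continuousWithinAt

theorem continuousOn_blissDensity {r : ℝ} (hr : 0 < r) (q : ℝ) :
    ContinuousOn (blissDensity r q) (Ici 0) :=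
  (Real.continuous_rpow_const hr.le).continuousOn.mul (continuous_one_add_rpow_rpow hr _)

theorem blissDensity_pos {r q t : ℝ} (ht : 0 < t) : 0 < blissDensity r q t := by
  unfold blissDensity; positivity

theorem one_add_rpow_rpow_le {r s t : ℝ} (hr : 0 < r) (hs : 0 ≤ s) (ht : 0 < t) :
    (1 + t ^ r) ^ (-(s / r)) ≤ t ^ (-s) := by
  calc (1 + t ^ r) ^ (-(s / r)) ≤ (t ^ r) ^ (-(s / r)) :=
        Real.rpow_le_rpow_of_nonpos (by positivity) (by linarith) (by
          have : 0 ≤ s / r := by positivity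
          linarith)
    _ = t ^ (-s) := by rw [← Real.rpow_mul ht.le]; congr 1; field_simp

theorem integrableOn_of_le_rpow {f : ℝ → ℝ} {s : ℝ} (hs : 1 < s) (hf : ContinuousOn f (Ici 0))
    (hf0 : ∀ t, 0 < t → 0 ≤ f t) (hfs : ∀ t, 0 < t → f t ≤ t ^ (-s)) :
    IntegrableOn f (Ioi 0) := by
  rw [← Ioc_union_Ioi_eq_Ioi zero_le_one]
  refine IntegrableOn.union ?_ ?_
  · exact ((hf.mono Icc_subset_Ici_self).integrableOn_Icc).mono_set Ioc_subset_Icc_self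
  · have hdom : IntegrableOn (fun t : ℝ => t ^ (-s)) (Ioi 1) :=
      integrableOn_Ioi_rpow_of_lt (by linarith) one_pos
    have hmeas : AEStronglyMeasurable f (volume.restrict (Ioi 1)) :=
      (hf.mono fun t (ht : 1 < t) => (zero_lt_one.trans ht).le).aestronglyMeasurable
        measurableSet_Ioi
    refine hdom.mono' hmeas ?_
    refine (ae_restrict_iff' measurableSet_Ioi).2 (.of_forall fun t ht => ?_)
    have ht : 0 < t := zero_lt_one.trans ht
    rw [Real.norm_of_nonneg (hf0 t ht)]
    exact hfs t ht

theorem integrableOn_blissDensity {r q : ℝ} (hr : 0 < r) (hq : r + 1 < q) :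
    IntegrableOn (blissDensity r q) (Ioi 0) := by
  refine integrableOn_of_le_rpow (s := q - r) (by linarith) (continuousOn_blissDensity hr q)
    (fun t ht => (blissDensity_pos ht).le) fun t ht => ?_
  calc blissDensity r q t ≤ t ^ r * t ^ (-q) := by
        unfold blissDensity
        gcongr
        exact one_add_rpow_rpow_le hr (by linarith) ht
    _ = _ := by rw [← Real.rpow_add ht]; congr 1; ring

theorem integrableOn_one_add_rpow_rpow {r q : ℝ} (hr : 0 < r) (hq : 1 < q) :
    IntegrableOn (fun t : ℝ => (1 + t ^ r) ^ (-(q / r))) (Ioi 0) :=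
  integrableOn_of_le_rpow hq (continuous_one_add_rpow_rpow hr _)
    (fun t ht => by positivity) fun t ht => one_add_rpow_rpow_le hr (by linarith) ht

theorem hasDerivAt_one_add_rpow_rpow {r t : ℝ} (s : ℝ) (ht : 0 < t) :
    HasDerivAt (fun t : ℝ => (1 + t ^ r) ^ s)
      (r * t ^ (r - 1) * s * (1 + t ^ r) ^ (s - 1)) t :=
  ((Real.hasDerivAt_rpow_const (.inl ht.ne')).const_add 1).rpow_const (.inl (by positivity))

theorem integral_one_add_rpow_rpow_eq {r q : ℝ} (hr : 0 < r) (hq : r + 1 < q) :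
    ∫ t in Ioi (0 : ℝ), (1 + t ^ r) ^ (-(q / r)) =
      (q - r - 1) * ∫ t in Ioi (0 : ℝ), blissDensity r q t := by
  have h1 := integrableOn_one_add_rpow_rpow hr (show 1 < q by linarith)
  have h2 := integrableOn_blissDensity hr hq
  have hlim : Filter.Tendsto (fun t : ℝ => t * (1 + t ^ r) ^ (-((q - r) / r))) Filter.atTop
      (nhds 0) := by
    refine squeeze_zero' (g := fun t => t ^ (-(q - r - 1))) ?_ ?_
      (tendsto_rpow_neg_atTop (by linarith))
    · filter_upwards [Filter.eventually_gt_atTop 0] with t ht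
      positivity
    · filter_upwards [Filter.eventually_gt_atTop 0] with t ht
      calc t * (1 + t ^ r) ^ (-((q - r) / r)) ≤ t ^ (1 : ℝ) * t ^ (-(q - r)) := by
            rw [Real.rpow_one]
            gcongr
            exact one_add_rpow_rpow_le hr (by linarith) ht
        _ = _ := by rw [← Real.rpow_add ht]; congr 1; ring
  have h3 := integral_Ioi_of_hasDerivAt_of_tendsto (a := 0)
    (f := fun t : ℝ => t * (1 + t ^ r) ^ (-((q - r) / r)))
    (f' := fun t : ℝ => (1 + t ^ r) ^ (-(q / r)) - (q - r - 1) * blissDensity r q t)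
    ((continuousOn_id.mul (continuous_one_add_rpow_rpow hr _)) 0 (by simp))
    (fun t ht => by
      have ht : 0 < t := ht
      refine ((hasDerivAt_id t).mul
        (hasDerivAt_one_add_rpow_rpow (r := r) (-((q - r) / r)) ht)).congr_deriv ?_
      have e1 : (1 + t ^ r) ^ (-((q - r) / r)) = (1 + t ^ r) ^ (-(q / r)) * (1 + t ^ r) := by
        rw [← Real.rpow_add_one (by positivity)]
        congr 1; field_simp; ring
      have e2 : -((q - r) / r) - 1 = -(q / r) := by field_simp; ring
      have e3 : t ^ r = t ^ (r - 1) * t := by rw [← Real.rpow_add_one ht.ne']; ring_nf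
      simp only [id, blissDensity]
      rw [e1, e2, e3]
      field_simp
      ring)
    (h1.sub (h2.const_mul _)) hlim
  rw [integral_sub h1 (h2.const_mul _), integral_const_mul] at h3
  simp only [zero_mul, sub_zero] at h3
  linarith

theorem integral_one_add_rpow_rpow_eq_betaFn {r : ℝ} (hr : 0 < r) (q : ℝ) :
    ∫ t in Ioi (0 : ℝ), (1 + t ^ r) ^ (-(q / r)) = 1 / r * betaFn (1 / r) ((q - 1) / r) := by
  have himg : (fun t : ℝ => 1 - (1 + t ^ r) ^ (-1 : ℝ)) '' Ioi 0 = Ioo 0 1 := by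
    ext s
    simp only [mem_image, mem_Ioi, mem_Ioo]
    constructor
    · rintro ⟨t, ht, rfl⟩
      have h0 : 0 < t ^ r := by positivity
      have h1 : (1 + t ^ r) ^ (-1 : ℝ) < 1 :=
        Real.rpow_lt_one_of_one_lt_of_neg (by linarith) (by norm_num)
      have h2 : 0 < (1 + t ^ r) ^ (-1 : ℝ) := by positivity
      constructor <;> linarith
    · rintro ⟨h0, h1⟩
      have h2 : 0 < s / (1 - s) := div_pos h0 (by linarith)
      refine ⟨(s / (1 - s)) ^ (1 / r), by positivity, ?_⟩
      rw [← Real.rpow_mul h2.le, one_div_mul_cancel hr.ne', Real.rpow_one, Real.rpow_neg_one]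
      have : 1 - s ≠ 0 := by linarith
      field_simp
      ring
  have hinj : InjOn (fun t : ℝ => 1 - (1 + t ^ r) ^ (-1 : ℝ)) (Ioi 0) := by
    intro t ht u hu h
    have ht : 0 < t := ht
    have hu : 0 < u := hu
    simp only [Real.rpow_neg_one, sub_right_inj, inv_inj, add_right_inj] at h
    exact (Real.rpow_left_inj ht.le hu.le hr.ne').1 h
  have hsub := integral_image_eq_integral_abs_deriv_smul measurableSet_Ioi
    (fun t (ht : 0 < t) => ((hasDerivAt_one_add_rpow_rpow (r := r) (-1) ht).const_sub
      1).hasDerivWithinAt) hinj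
    (fun s : ℝ => s ^ (1 / r - 1) * (1 - s) ^ ((q - 1) / r - 1))
  rw [himg] at hsub
  rw [betaFn, hsub, ← integral_const_mul]
  refine setIntegral_congr_fun measurableSet_Ioi fun t ht => ?_
  have ht : 0 < t := ht
  have h0 : 0 < 1 + t ^ r := by positivity
  have e1 : 1 - (1 + t ^ r) ^ (-1 : ℝ) = t ^ r * (1 + t ^ r) ^ (-1 : ℝ) := by
    rw [Real.rpow_neg_one]; field_simp; ring
  have e2 : |-(r * t ^ (r - 1) * -1 * (1 + t ^ r) ^ ((-1 : ℝ) - 1))| =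
      r * t ^ (r - 1) * (1 + t ^ r) ^ (-2 : ℝ) := by
    rw [abs_of_nonneg]
    · norm_num
    · have : 0 ≤ r * t ^ (r - 1) * (1 + t ^ r) ^ ((-1 : ℝ) - 1) := by positivity
      linarith
  simp only [smul_eq_mul]
  rw [e2, sub_sub_cancel, e1, Real.mul_rpow (by positivity) (by positivity),
    ← Real.rpow_mul ht.le, ← Real.rpow_mul h0.le, ← Real.rpow_mul h0.le]
  have e3 : t ^ (r * (1 / r - 1)) * t ^ (r - 1) = 1 := by
    rw [← Real.rpow_add ht, show r * (1 / r - 1) + (r - 1) = 0 by field_simp; ring,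
      Real.rpow_zero]
  have e4 : (1 + t ^ r) ^ (-1 * (1 / r - 1)) * (1 + t ^ r) ^ (-1 * ((q - 1) / r - 1)) *
      (1 + t ^ r) ^ (-2 : ℝ) = (1 + t ^ r) ^ (-(q / r)) := by
    rw [← Real.rpow_add h0, ← Real.rpow_add h0]
    congr 1; field_simp; ring
  calc (1 + t ^ r) ^ (-(q / r)) = (1 / r * r) * (t ^ (r * (1 / r - 1)) * t ^ (r - 1)) *
        ((1 + t ^ r) ^ (-1 * (1 / r - 1)) * (1 + t ^ r) ^ (-1 * ((q - 1) / r - 1)) *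
          (1 + t ^ r) ^ (-2 : ℝ)) := by
        rw [one_div_mul_cancel hr.ne', e3, e4, one_mul, one_mul]
    _ = _ := by ring

/-- A function on `(0, ∞)` with positive derivative increasing from `0` to `1` has a
differentiable inverse. -/
theorem exists_hasDerivAt_inverse {N N' : ℝ → ℝ} (hN : ∀ y, 0 < y → HasDerivAt N (N' y) y)
    (hN' : ∀ y, 0 < y → 0 < N' y) (h0 : Filter.Tendsto N (nhdsWithin 0 (Ioi 0)) (nhds 0))
    (h1 : Filter.Tendsto N Filter.atTop (nhds 1)) :
    ∃ Y : ℝ → ℝ, ∀ j ∈ Ioo (0 : ℝ) 1, 0 < Y j ∧ HasDerivAt Y (N' (Y j))⁻¹ j := by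
  have hcont : ContinuousOn N (Ioi 0) := fun y hy => (hN y hy).continuousAt.continuousWithinAt
  have hmono : StrictMonoOn N (Ioi 0) := strictMonoOn_of_deriv_pos (convex_Ioi 0) hcont
    fun y hy => by
      rw [interior_Ioi] at hy
      rw [(hN y hy).deriv]; exact hN' y hy
  have hex : ∀ j ∈ Ioo (0 : ℝ) 1, ∃ y, 0 < y ∧ N y = j := by
    intro j hj
    obtain ⟨a, haj, ha⟩ := ((h0.eventually (gt_mem_nhds hj.1)).and self_mem_nhdsWithin).exists
    obtain ⟨b, hbj, hab⟩ :=
      ((h1.eventually (lt_mem_nhds hj.2)).and (Filter.eventually_gt_atTop a)).exists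
    obtain ⟨y, hy, hyj⟩ := intermediate_value_Icc hab.le
      (hcont.mono fun z hz => lt_of_lt_of_le ha hz.1) ⟨haj.le, hbj.le⟩
    exact ⟨y, lt_of_lt_of_le ha hy.1, hyj⟩
  have hlt : ∀ y, 0 < y → N y ∈ Ioo (0 : ℝ) 1 := by
    intro y hy
    have hy2 : 0 < y / 2 := by positivity
    constructor
    · refine lt_of_le_of_lt ?_ (hmono hy2 hy (by linarith))
      refine le_of_tendsto h0 ?_
      filter_upwards [Ioo_mem_nhdsGT hy2] with z hz
      exact (hmono hz.1 hy2 hz.2).le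
    · refine lt_of_lt_of_le (hmono hy (show 0 < y + 1 by linarith) (by linarith)) ?_
      refine ge_of_tendsto h1 ?_
      filter_upwards [Filter.eventually_ge_atTop (y + 1)] with z hz
      exact hmono.monotoneOn (show 0 < y + 1 by linarith) (show 0 < z by linarith) hz
  choose! Y hY0 hY using hex
  have hYN : ∀ y, 0 < y → Y (N y) = y := fun y hy =>
    hmono.injOn (hY0 _ (hlt y hy)) hy (hY _ (hlt y hy))
  have hYmono : StrictMonoOn Y (Ioo 0 1) := fun i hi j hj hij => by
    rw [← hmono.lt_iff_lt (hY0 i hi) (hY0 j hj), hY i hi, hY j hj]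
    exact hij
  refine ⟨Y, fun j hj => ⟨hY0 j hj, ?_⟩⟩
  have hnhds : Ioo (0 : ℝ) 1 ∈ nhds j := Ioo_mem_nhds hj.1 hj.2
  have himg : Ioi 0 ⊆ Y '' Ioo 0 1 := fun y hy => ⟨N y, hlt y hy, hYN y hy⟩
  refine HasDerivAt.of_local_left_inverse ?_ (hN _ (hY0 j hj)) (hN' _ (hY0 j hj)).ne' ?_
  · exact hYmono.continuousAt_of_image_mem_nhds hnhds
      (Filter.mem_of_superset (Ioi_mem_nhds (hY0 j hj)) himg)
  · filter_upwards [hnhds] with i hi using hY i hi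

theorem mul_rpow_sub_one_mul_sub_le_rpow {p T g : ℝ} (hp : 1 < p) (hT : 0 ≤ T) (hg : 0 ≤ g) :
    p * (T ^ (p - 1) * g) - (p - 1) * T ^ p ≤ g ^ p := by
  have hc := Real.HolderConjugate.conjExponent hp
  have h := Real.young_inequality_of_nonneg hg (Real.rpow_nonneg hT (p - 1)) hc
  rw [← Real.rpow_mul hT, hc.sub_one_mul_conj, Real.conjExponent] at h
  have hp0 : 0 < p := by linarith
  have h2 : p * (g ^ p / p + T ^ p / (p / (p - 1))) = g ^ p + (p - 1) * T ^ p := by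
    field_simp
  have h3 := mul_le_mul_of_nonneg_left h hp0.le
  rw [h2] at h3
  linarith

theorem rpow_mul_rpow_le_add {r X Z : ℝ} (hr : 0 < r) (hX : 0 ≤ X) (hZ : 0 ≤ Z) :
    (r + 1) * (X ^ (1 / (r + 1)) * Z ^ (r / (r + 1))) ≤ X + r * Z := by
  have h := Real.geom_mean_le_arith_mean2_weighted (w₁ := 1 / (r + 1)) (w₂ := r / (r + 1))
    (by positivity) (by positivity) hX hZ (by field_simp; ring)
  have h2 : (r + 1) * (1 / (r + 1) * X + r / (r + 1) * Z) = X + r * Z := by field_simp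
  rw [← h2]
  exact mul_le_mul_of_nonneg_left h (by positivity)

/-- The pointwise inequality behind Bliss' inequality. -/
theorem bliss_pointwise {p q r L J x F g Y : ℝ} (hp : 1 < p) (hr : 0 < r) (hq : q = p * (r + 1))
    (hL : 0 < L) (hJ : 0 < J) (hx : 0 < x) (hF : 0 < F) (hg : 0 ≤ g) (hY : 0 < Y) :
    (p - 1) * (r + 1) * (L / J) ^ (r / (r + 1)) * (x ^ (r - q) * F ^ q) +
      ((r * Y ^ (r - 1) * (1 - p) * (1 + Y ^ r) ^ (1 - p - 1) *
            ((blissDensity r q Y / L)⁻¹ * (x ^ (r - q) * F ^ q / J)) * x ^ (1 - p) +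
          (1 + Y ^ r) ^ (1 - p) * ((1 - p) * x ^ (1 - p - 1))) * F ^ p +
        (1 + Y ^ r) ^ (1 - p) * x ^ (1 - p) * (g * p * F ^ (p - 1))) ≤ g ^ p := by
  have hD : 0 < 1 + Y ^ r := by positivity
  have hD1 : Y ^ r = (1 + Y ^ r) - 1 := by ring
  unfold blissDensity
  set D := 1 + Y ^ r with hDdef
  have hT := mul_rpow_sub_one_mul_sub_le_rpow (T := F / (D * x)) hp (by positivity) hg
  have hAM := rpow_mul_rpow_le_add (X := D ^ (-p) * Y ^ r * x ^ (-p) * F ^ p)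
    (Z := L * D ^ (q / r - p) * Y⁻¹ * x ^ (1 - p + r - q) * F ^ (p + q) / J) hr
    (by positivity) (by positivity)
  have hX : D ^ (-p) * Y ^ r * x ^ (-p) * F ^ p =
      D ^ (1 - p) * x ^ (-p) * F ^ p - (F / (D * x)) ^ p := by
    rw [Real.div_rpow hF.le (by positivity), Real.mul_rpow hD.le hx.le, sub_eq_add_neg 1 p,
      Real.rpow_add hD, Real.rpow_one, Real.rpow_neg hD.le, Real.rpow_neg hx.le, hD1]
    field_simp
  have hTp : (F / (D * x)) ^ (p - 1) = D ^ (1 - p) * x ^ (1 - p) * F ^ (p - 1) := by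
    rw [Real.div_rpow hF.le (by positivity), Real.mul_rpow hD.le hx.le,
      show 1 - p = -(p - 1) by ring, Real.rpow_neg hD.le, Real.rpow_neg hx.le]
    field_simp
  have hZ : r * Y ^ (r - 1) * (1 - p) * D ^ (1 - p - 1) *
      ((Y ^ r * D ^ (-(q / r)) / L)⁻¹ * (x ^ (r - q) * F ^ q / J)) * x ^ (1 - p) * F ^ p =
      -(p - 1) * (r * (L * D ^ (q / r - p) * Y⁻¹ * x ^ (1 - p + r - q) * F ^ (p + q) / J)) := by
    have e1 : D ^ (q / r - p) = D ^ (1 - p - 1) * D ^ (q / r) := by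
      rw [← Real.rpow_add hD]; congr 1; ring
    have e2 : x ^ (1 - p + r - q) = x ^ (1 - p) * x ^ (r - q) := by
      rw [← Real.rpow_add hx]; congr 1; ring
    have e3 : Y ^ r = Y ^ (r - 1) * Y := by rw [← Real.rpow_add_one hY.ne']; congr 1; ring
    rw [e1, e2, e3, Real.rpow_add hF, Real.rpow_neg hD.le]
    field_simp
    ring
  have hXZ : (D ^ (-p) * Y ^ r * x ^ (-p) * F ^ p) ^ (1 / (r + 1)) *
      (L * D ^ (q / r - p) * Y⁻¹ * x ^ (1 - p + r - q) * F ^ (p + q) / J) ^ (r / (r + 1)) =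
      (L / J) ^ (r / (r + 1)) * (x ^ (r - q) * F ^ q) := by
    clear hX hZ hTp hT hAM hDdef hD1
    clear_value D
    obtain ⟨d, rfl⟩ : ∃ d, Real.exp d = D := ⟨_, Real.exp_log hD⟩
    obtain ⟨y, rfl⟩ : ∃ d, Real.exp d = Y := ⟨_, Real.exp_log hY⟩
    obtain ⟨a, rfl⟩ : ∃ d, Real.exp d = x := ⟨_, Real.exp_log hx⟩
    obtain ⟨f, rfl⟩ : ∃ d, Real.exp d = F := ⟨_, Real.exp_log hF⟩
    obtain ⟨l, rfl⟩ : ∃ d, Real.exp d = L := ⟨_, Real.exp_log hL⟩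
    obtain ⟨j, rfl⟩ : ∃ d, Real.exp d = J := ⟨_, Real.exp_log hJ⟩
    simp only [← Real.exp_mul, ← Real.exp_add, ← Real.exp_neg, ← Real.exp_sub]
    congr 1
    subst hq
    field_simp
    ring
  have hxp : x ^ (1 - p - 1) = x ^ (-p) := by congr 1; ring
  rw [hXZ] at hAM
  rw [hTp] at hT
  rw [hX] at hAM
  rw [add_mul, hZ, hxp]
  have := mul_le_mul_of_nonneg_left hAM (show 0 ≤ p - 1 by linarith)
  linarith

theorem integral_blissDensity_pos {r q : ℝ} (hr : 0 < r) (hq : r + 1 < q) :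
    0 < ∫ t in Ioi (0 : ℝ), blissDensity r q t := by
  rw [setIntegral_pos_iff_support_of_nonneg_ae
    ((ae_restrict_iff' measurableSet_Ioi).2 (.of_forall fun t ht => (blissDensity_pos ht).le))
    (integrableOn_blissDensity hr hq)]
  have : Function.support (blissDensity r q) ∩ Ioi 0 = Ioi 0 :=
    inter_eq_right.2 fun t ht => (blissDensity_pos ht).ne'
  simp [this]

/-- The inverse of the normalized primitive of `blissDensity`. -/
theorem exists_bliss_transport {r q : ℝ} (hr : 0 < r) (hq : r + 1 < q) :
    ∃ Y : ℝ → ℝ, ∀ j ∈ Ioo (0 : ℝ) 1, 0 < Y j ∧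
      HasDerivAt Y (blissDensity r q (Y j) / ∫ t in Ioi (0 : ℝ), blissDensity r q t)⁻¹ j := by
  have hL := integral_blissDensity_pos hr hq
  have hint := integrableOn_blissDensity hr hq
  have hcont := continuousOn_blissDensity hr q
  have hii : ∀ y, 0 ≤ y → IntervalIntegrable (blissDensity r q) volume 0 y := fun y hy =>
    (hcont.mono (by rw [uIcc_of_le hy]; exact Icc_subset_Ici_self)).intervalIntegrable
  refine exists_hasDerivAt_inverse
    (N := fun y => (∫ t in (0 : ℝ)..y, blissDensity r q t) / ∫ t in Ioi (0 : ℝ), blissDensity r q t)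
    (N' := fun y => blissDensity r q y / ∫ t in Ioi (0 : ℝ), blissDensity r q t)
    (fun y hy => ?_) (fun y hy => div_pos (blissDensity_pos hy) hL) ?_ ?_
  · have hc : ContinuousAt (blissDensity r q) y := hcont.continuousAt (Ici_mem_nhds hy)
    refine (intervalIntegral.integral_hasDerivAt_right (hii y hy.le) ?_ hc).div_const _
    exact (hcont.mono Ioi_subset_Ici_self).stronglyMeasurableAtFilter isOpen_Ioi y hy
  · have h1 : ContinuousWithinAt (fun y => ∫ t in (0 : ℝ)..y, blissDensity r q t) (Ici 0) 0 := by
      have := intervalIntegral.continuousOn_primitive_interval (μ := volume) (a := 0) (b := 1)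
        (f := blissDensity r q) (by
          rw [uIcc_of_le zero_le_one]
          exact (hcont.mono Icc_subset_Ici_self).integrableOn_Icc)
      rw [uIcc_of_le zero_le_one] at this
      exact (this 0 (by simp)).mono_of_mem_nhdsWithin (Icc_mem_nhdsGE zero_lt_one)
    have h2 := (h1.mono Ioi_subset_Ici_self).tendsto.div_const
      (∫ t in Ioi (0 : ℝ), blissDensity r q t)
    simpa using h2
  · have h1 := (intervalIntegral_tendsto_integral_Ioi 0 hint Filter.tendsto_id).div_const
      (∫ t in Ioi (0 : ℝ), blissDensity r q t)
    rwa [div_self hL.ne'] at h1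

theorem lipschitzOnWith_rpow_Icc {p : ℝ} (hp : 1 ≤ p) {B : ℝ} (hB : 0 ≤ B) :
    LipschitzOnWith (p * B ^ (p - 1)).toNNReal (fun t : ℝ => t ^ p) (Icc 0 B) := by
  refine (convex_Icc 0 B).lipschitzOnWith_of_nnnorm_hasDerivWithin_le
    (fun t _ => (Real.hasDerivAt_rpow_const (.inr hp)).hasDerivWithinAt) fun t ht => ?_
  rw [← NNReal.coe_le_coe, coe_nnnorm, Real.coe_toNNReal _ (by positivity), Real.norm_of_nonneg
    (by have := ht.1; positivity)]
  exact mul_le_mul_of_nonneg_left (Real.rpow_le_rpow ht.1 ht.2 (by linarith)) (by linarith)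

theorem bliss_interval {p q r c d x₁ : ℝ} {K : NNReal} {F g : ℝ → ℝ} (hp : 1 < p) (hr : 0 < r)
    (hq : q = p * (r + 1)) (hx₁ : 0 < x₁) (hFlip : LipschitzWith K F) (hFmono : Monotone F)
    (hF : ∀ x, x₁ < x → 0 < F x) (hFg : ∀ᵐ x, HasDerivAt F (g x) x) (hg : ∀ x, 0 ≤ g x)
    (hgint : IntervalIntegrable (fun x => g x ^ p) volume c d)
    (hh : IntegrableOn (fun x => x ^ (r - q) * F x ^ q) (Ioi x₁)) (hc : x₁ < c) (hcd : c ≤ d) :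
    (p - 1) * (r + 1) * ((∫ t in Ioi (0 : ℝ), blissDensity r q t) /
        ∫ x in Ioi x₁, x ^ (r - q) * F x ^ q) ^ (r / (r + 1)) *
        (∫ x in c..d, x ^ (r - q) * F x ^ q) ≤
      (∫ x in c..d, g x ^ p) + x₁ ^ (1 - p) * F c ^ p := by
  have hrq : r + 1 < q := by nlinarith
  set L := ∫ t in Ioi (0 : ℝ), blissDensity r q t with hLdef
  have hL : 0 < L := integral_blissDensity_pos hr hrq
  set h : ℝ → ℝ := fun x => x ^ (r - q) * F x ^ q with hhdef
  set J := ∫ x in Ioi x₁, h x with hJdef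
  have hpos : ∀ x, x₁ < x → 0 < h x := fun x hx =>
    mul_pos (Real.rpow_pos_of_pos (hx₁.trans hx) _) (Real.rpow_pos_of_pos (hF x hx) _)
  have hhcont : ContinuousOn h (Ioi x₁) := fun x hx =>
    ((Real.continuousAt_rpow_const _ _ (.inl (hx₁.trans hx).ne')).mul
      (hFlip.continuous.continuousAt.rpow_const (.inl (hF x hx).ne'))).continuousWithinAt
  have hii : ∀ x y, x₁ ≤ x → x₁ ≤ y → IntervalIntegrable h volume x y := fun x y hx hy =>
    (intervalIntegrable_iff.2 (hh.mono_set fun z hz => lt_of_le_of_lt (le_min hx hy) hz.1))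
  have hjlt : ∀ x, x₁ < x → 0 < ∫ t in x₁..x, h t := fun x hx =>
    intervalIntegral.intervalIntegral_pos_of_pos_on (hii _ _ le_rfl hx.le)
      (fun t ht => hpos t ht.1) hx
  have hjJ : ∀ x, x₁ < x → ∫ t in x₁..x, h t < J := by
    intro x hx
    have h1 : (∫ t in x₁..x, h t) + ∫ t in x..(x + 1), h t = ∫ t in x₁..(x + 1), h t :=
      intervalIntegral.integral_add_adjacent_intervals (hii _ _ le_rfl hx.le)
        (hii _ _ hx.le (by linarith))
    have h2 : 0 < ∫ t in x..(x + 1), h t :=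
      intervalIntegral.intervalIntegral_pos_of_pos_on (hii _ _ hx.le (by linarith))
        (fun t ht => hpos t (hx.trans ht.1)) (by linarith)
    have h3 : ∫ t in x₁..(x + 1), h t ≤ J := by
      rw [intervalIntegral.integral_of_le (by linarith)]
      exact setIntegral_mono_set hh ((ae_restrict_iff' measurableSet_Ioi).2
        (.of_forall fun t ht => (hpos t ht).le)) Ioc_subset_Ioi_self.eventuallyLE
    linarith
  have hJ : 0 < J := (hjlt c hc).trans (hjJ c hc)
  obtain ⟨Y, hY⟩ := exists_bliss_transport hr hrq
  set j : ℝ → ℝ := fun x => (∫ t in x₁..x, h t) / J with hjdef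
  have hj01 : ∀ x, x₁ < x → j x ∈ Ioo (0 : ℝ) 1 := fun x hx =>
    ⟨div_pos (hjlt x hx) hJ, (div_lt_one hJ).2 (hjJ x hx)⟩
  have hjd : ∀ x, x₁ < x → HasDerivAt j (h x / J) x := fun x hx =>
    (intervalIntegral.integral_hasDerivAt_right (hii _ _ le_rfl hx.le)
      (hhcont.stronglyMeasurableAtFilter isOpen_Ioi x hx)
      (hhcont.continuousAt (Ioi_mem_nhds hx))).div_const _
  set y : ℝ → ℝ := fun x => Y (j x) with hydef
  have hy0 : ∀ x, x₁ < x → 0 < y x := fun x hx => (hY _ (hj01 x hx)).1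
  have hyd : ∀ x, x₁ < x → HasDerivAt y ((blissDensity r q (y x) / L)⁻¹ * (h x / J)) x :=
    fun x hx => (hY _ (hj01 x hx)).2.comp x (hjd x hx)
  set Ψ : ℝ → ℝ := fun x => (1 + y x ^ r) ^ (1 - p) * x ^ (1 - p) with hΨdef
  set Ψ' : ℝ → ℝ := fun x => r * y x ^ (r - 1) * (1 - p) * (1 + y x ^ r) ^ (1 - p - 1) *
      ((blissDensity r q (y x) / L)⁻¹ * (h x / J)) * x ^ (1 - p) +
    (1 + y x ^ r) ^ (1 - p) * ((1 - p) * x ^ (1 - p - 1)) with hΨ'def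
  have hΨd : ∀ x, x₁ < x → HasDerivAt Ψ (Ψ' x) x := fun x hx =>
    ((hasDerivAt_one_add_rpow_rpow (1 - p) (hy0 x hx)).comp x (hyd x hx)).mul
      (Real.hasDerivAt_rpow_const (.inl (hx₁.trans hx).ne'))
  have hsub : ∀ x ∈ Icc c d, x₁ < x := fun x hx => hc.trans_le hx.1
  have hΨ'cont : ContinuousOn Ψ' (Icc c d) := by
    intro x hx
    have hx1 := hsub x hx
    have hx0 : x ≠ 0 := (hx₁.trans hx1).ne'
    have hyc : ContinuousAt y x := (hyd x hx1).continuousAt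
    have hhc : ContinuousAt h x := hhcont.continuousAt (Ioi_mem_nhds hx1)
    have hbc : ContinuousAt (fun x => blissDensity r q (y x)) x :=
      ContinuousAt.comp (g := blissDensity r q)
        ((continuousOn_blissDensity hr q).continuousAt (Ici_mem_nhds (hy0 x hx1))) hyc
    have hb0 : blissDensity r q (y x) / L ≠ 0 := (div_pos (blissDensity_pos (hy0 x hx1)) hL).ne'
    have hy1 : y x ≠ 0 := (hy0 x hx1).ne'
    have hD : 1 + y x ^ r ≠ 0 := by have := hy0 x hx1; positivity
    have hDc : ContinuousAt (fun x => 1 + y x ^ r) x :=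
      continuousAt_const.add (hyc.rpow_const (.inl hy1))
    have hpow : ∀ s : ℝ, ContinuousAt (fun x : ℝ => x ^ s) x := fun s =>
      Real.continuousAt_rpow_const _ _ (.inl hx0)
    exact (((((continuousAt_const.mul (hyc.rpow_const (.inl hy1))).mul continuousAt_const).mul
      (hDc.rpow_const (.inl hD))).mul (((hbc.div_const L).inv₀ hb0).mul (hhc.div_const J))).mul
      (hpow _)).add ((hDc.rpow_const (.inl hD)).mul
        (continuousAt_const.mul (hpow _))) |>.continuousWithinAt
  have hΨac : AbsolutelyContinuousOnInterval Ψ c d := by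
    obtain ⟨B, hB⟩ := isCompact_Icc.exists_bound_of_continuousOn hΨ'cont
    refine LipschitzOnWith.absolutelyContinuousOnInterval (K := B.toNNReal) ?_
    rw [uIcc_of_le hcd]
    refine (convex_Icc c d).lipschitzOnWith_of_nnnorm_hasDerivWithin_le
      (fun x hx => (hΨd x (hsub x hx)).hasDerivWithinAt) fun x hx => ?_
    rw [← NNReal.coe_le_coe, coe_nnnorm]
    exact (hB x hx).trans (Real.le_coe_toNNReal B)
  have hFpac : AbsolutelyContinuousOnInterval (fun x => F x ^ p) c d := by
    have hFd := hF d (hc.trans_le hcd)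
    refine LipschitzOnWith.absolutelyContinuousOnInterval
      (K := (p * F d ^ (p - 1)).toNNReal * K) ?_
    rw [uIcc_of_le hcd]
    exact (lipschitzOnWith_rpow_Icc hp.le hFd.le).comp hFlip.lipschitzOnWith
      fun x hx => ⟨(hF x (hsub x hx)).le, hFmono hx.2⟩
  have hWac : AbsolutelyContinuousOnInterval (fun x => Ψ x * F x ^ p) c d := hΨac.mul hFpac
  have hFTC : ∫ x in c..d, deriv (fun x => Ψ x * F x ^ p) x = Ψ d * F d ^ p - Ψ c * F c ^ p :=
    hWac.integral_deriv_eq_sub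
  have hle : ∫ x in c..d, ((p - 1) * (r + 1) * (L / J) ^ (r / (r + 1)) * h x +
      deriv (fun x => Ψ x * F x ^ p) x) ≤ ∫ x in c..d, g x ^ p := by
    refine intervalIntegral.integral_mono_ae_restrict hcd
      (((hii c d hc.le (hc.le.trans hcd)).const_mul _).add hWac.intervalIntegrable_deriv) hgint ?_
    filter_upwards [ae_restrict_of_ae hFg, ae_restrict_mem measurableSet_Icc] with x hxF hx
    have hx1 := hsub x hx
    have hd : HasDerivAt (fun x => Ψ x * F x ^ p)
        (Ψ' x * F x ^ p + Ψ x * (g x * p * F x ^ (p - 1))) x :=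
      (hΨd x hx1).mul (hxF.rpow_const (.inl (hF x hx1).ne'))
    rw [hd.deriv]
    exact bliss_pointwise hp hr hq hL hJ (hx₁.trans hx1) (hF x hx1) (hg x) (hy0 x hx1)
  rw [intervalIntegral.integral_add ((hii c d hc.le (hc.le.trans hcd)).const_mul _)
    hWac.intervalIntegrable_deriv, intervalIntegral.integral_const_mul] at hle
  rw [hFTC] at hle
  have hWd : 0 ≤ Ψ d * F d ^ p := by
    have hd := hc.trans_le hcd
    have h1 := hy0 d hd
    have h2 := hF d hd
    have h3 := hx₁.trans hd
    positivity
  have hWc : Ψ c * F c ^ p ≤ x₁ ^ (1 - p) * F c ^ p := by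
    have h1 := hy0 c hc
    have h2 := hF c hc
    have h3 := hx₁.trans hc
    refine mul_le_mul_of_nonneg_right ?_ (by positivity)
    calc (1 + y c ^ r) ^ (1 - p) * c ^ (1 - p) ≤ 1 * x₁ ^ (1 - p) := by
          refine mul_le_mul ?_ ?_ (by positivity) zero_le_one
          · refine Real.rpow_le_one_of_one_le_of_nonpos ?_ (by linarith)
            have : 0 < y c ^ r := by positivity
            linarith
          · exact Real.rpow_le_rpow_of_nonpos hx₁ hc.le (by linarith)
      _ = _ := one_mul _
  linarith

theorem bliss_integral_pos {p q r x₁ : ℝ} {K : NNReal} {F g : ℝ → ℝ} (hp : 1 < p) (hr : 0 < r)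
    (hq : q = p * (r + 1)) (hx₁ : 0 < x₁) (hFlip : LipschitzWith K F) (hFmono : Monotone F)
    (hFx₁ : F x₁ = 0) (hF : ∀ x, x₁ < x → 0 < F x) (hFg : ∀ᵐ x, HasDerivAt F (g x) x)
    (hg : ∀ x, 0 ≤ g x) (hgint : IntegrableOn (fun x => g x ^ p) (Ioi 0))
    (hh : IntegrableOn (fun x => x ^ (r - q) * F x ^ q) (Ioi x₁)) :
    (p - 1) * (r + 1) * ((∫ t in Ioi (0 : ℝ), blissDensity r q t) /
        ∫ x in Ioi x₁, x ^ (r - q) * F x ^ q) ^ (r / (r + 1)) *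
        (∫ x in Ioi x₁, x ^ (r - q) * F x ^ q) ≤ ∫ x in Ioi 0, g x ^ p := by
  set κ := (p - 1) * (r + 1) * ((∫ t in Ioi (0 : ℝ), blissDensity r q t) /
    ∫ x in Ioi x₁, x ^ (r - q) * F x ^ q) ^ (r / (r + 1)) with hκ
  set h : ℝ → ℝ := fun x => x ^ (r - q) * F x ^ q with hhdef
  have hg0 : ∀ x, 0 ≤ g x ^ p := fun x => Real.rpow_nonneg (hg x) p
  have hcd : ∀ c, x₁ < c → ∀ d, c ≤ d →
      κ * (∫ x in c..d, h x) ≤ (∫ x in Ioi 0, g x ^ p) + x₁ ^ (1 - p) * F c ^ p := by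
    intro c hc d hd
    have hsub : Ioc c d ⊆ Ioi 0 := fun x hx => hx₁.trans (hc.trans hx.1)
    refine (bliss_interval hp hr hq hx₁ hFlip hFmono hF hFg hg
      ((intervalIntegrable_iff_integrableOn_Ioc_of_le hd).2 (hgint.mono_set hsub)) hh hc hd).trans ?_
    gcongr
    rw [intervalIntegral.integral_of_le hd]
    exact setIntegral_mono_set hgint (.of_forall hg0) hsub.eventuallyLE
  have hc : ∀ c, x₁ < c → κ * ((∫ x in Ioi x₁, h x) - ∫ x in x₁..c, h x) ≤
      (∫ x in Ioi 0, g x ^ p) + x₁ ^ (1 - p) * F c ^ p := by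
    intro c hc
    have hhc := hh.mono_set (Ioi_subset_Ioi hc.le)
    have h1 : (∫ x in x₁..c, h x) + ∫ x in Ioi c, h x = ∫ x in Ioi x₁, h x := by
      rw [intervalIntegral.integral_of_le hc.le, ← Ioc_union_Ioi_eq_Ioi hc.le]
      exact (setIntegral_union (Ioc_disjoint_Ioi le_rfl) measurableSet_Ioi
        (hh.mono_set Ioc_subset_Ioi_self) hhc).symm
    rw [← h1, add_sub_cancel_left]
    refine le_of_tendsto ((intervalIntegral_tendsto_integral_Ioi c hhc
      Filter.tendsto_id).const_mul κ) ?_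
    filter_upwards [Filter.eventually_ge_atTop c] with d hd using hcd c hc d hd
  have hcont : ContinuousOn (fun c => ∫ x in x₁..c, h x) (uIcc x₁ (x₁ + 1)) := by
    refine intervalIntegral.continuousOn_primitive_interval ?_
    rw [uIcc_of_le (by linarith), integrableOn_Icc_iff_integrableOn_Ioc]
    exact hh.mono_set Ioc_subset_Ioi_self
  have hlim1 : Filter.Tendsto (fun c => ∫ x in x₁..c, h x) (nhdsWithin x₁ (Ioi x₁)) (nhds 0) := by
    have h1 := hcont x₁ left_mem_uIcc
    rw [uIcc_of_le (by linarith)] at h1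
    have h2 := (h1.mono_of_mem_nhdsWithin (Icc_mem_nhdsGE (by linarith : x₁ < x₁ + 1))).mono
      Ioi_subset_Ici_self
    simpa [ContinuousWithinAt] using h2
  have hlim2 : Filter.Tendsto (fun c => F c ^ p) (nhdsWithin x₁ (Ioi x₁)) (nhds 0) := by
    have h1 : ContinuousAt (fun c => F c ^ p) x₁ :=
      hFlip.continuous.continuousAt.rpow_const (.inr (by linarith))
    have h2 := h1.tendsto
    rw [hFx₁, Real.zero_rpow (by linarith)] at h2
    exact h2.mono_left nhdsWithin_le_nhds
  have := le_of_tendsto_of_tendsto ((tendsto_const_nhds.sub hlim1).const_mul κ)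
    (tendsto_const_nhds.add (hlim2.const_mul (x₁ ^ (1 - p))))
    (by filter_upwards [self_mem_nhdsWithin] with c hc' using hc c hc')
  simpa using this

theorem integrable_rpow_of_le_of_eq_zero {a b M s : ℝ} {g : ℝ → ℝ} (hs : 0 < s)
    (hgm : Measurable g) (hg : ∀ x, 0 ≤ g x) (hgM : ∀ x, g x ≤ M)
    (hgab : ∀ x ∉ Ioc a b, g x = 0) : Integrable fun x => g x ^ s := by
  refine (integrableOn_iff_integrable_of_support_subset (s := Ioc a b) fun x hx =>
    by_contra fun h => hx ?_).1 (Measure.integrableOn_of_bounded (M := M ^ s) (by simp)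
      (hgm.pow_const s).aestronglyMeasurable (.of_forall fun x => ?_))
  · simp only [hgab x h, Real.zero_rpow hs.ne']
  · rw [Real.norm_of_nonneg (Real.rpow_nonneg (hg x) s)]
    exact Real.rpow_le_rpow (hg x) (hgM x) hs.le

/-- Bliss' inequality for bounded functions supported away from the origin and from infinity. -/
theorem bliss_integral {p q r a b M : ℝ} {g : ℝ → ℝ} (hp : 1 < p) (hr : 0 < r)
    (hq : q = p * (r + 1)) (ha : 0 < a) (hgm : Measurable g) (hg : ∀ x, 0 ≤ g x)
    (hgM : ∀ x, g x ≤ M) (hgab : ∀ x ∉ Ioc a b, g x = 0) :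
    IntegrableOn (fun x => x ^ (r - q) * (∫ t in (0 : ℝ)..x, g t) ^ q) (Ioi 0) ∧
    (p - 1) * (r + 1) * ((∫ t in Ioi (0 : ℝ), blissDensity r q t) ^ (r / (r + 1)) *
        (∫ x in Ioi 0, x ^ (r - q) * (∫ t in (0 : ℝ)..x, g t) ^ q) ^ (1 / (r + 1))) ≤
      ∫ x in Ioi 0, g x ^ p := by
  have hrq : r + 1 < q := by nlinarith
  have hM : 0 ≤ M := (hg 0).trans (hgM 0)
  have hgpi := integrable_rpow_of_le_of_eq_zero (by linarith : 0 < p) hgm hg hgM hgab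
  have hgi : Integrable g := by
    simpa using integrable_rpow_of_le_of_eq_zero one_pos hgm hg hgM hgab
  set F : ℝ → ℝ := fun x => ∫ t in (0 : ℝ)..x, g t with hFdef
  have hsub : ∀ x y, F y - F x = ∫ t in x..y, g t := fun x y =>
    intervalIntegral.integral_interval_sub_left hgi.intervalIntegrable hgi.intervalIntegrable
  have hFlip : LipschitzWith M.toNNReal F := by
    refine LipschitzWith.of_dist_le_mul fun x y => ?_
    rw [Real.dist_eq, Real.dist_eq, hsub y x, Real.coe_toNNReal M hM, ← Real.norm_eq_abs]
    exact intervalIntegral.norm_integral_le_of_norm_le_const fun t _ => by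
      rw [Real.norm_of_nonneg (hg t)]; exact hgM t
  have hFmono : Monotone F := fun x y hxy => by
    have := intervalIntegral.integral_nonneg (μ := volume) hxy fun t _ => hg t
    rw [← hsub] at this
    linarith
  have hF00 : F 0 = 0 := by simp [hFdef]
  have hF0 : ∀ x, 0 ≤ x → 0 ≤ F x := fun x hx => hF00 ▸ hFmono hx
  have hFa : F a = 0 := by
    rw [hFdef]
    refine intervalIntegral.integral_zero_ae (.of_forall fun t ht => hgab t fun h => ?_)
    rw [uIoc_of_le ha.le] at ht
    exact (ht.2.trans_lt h.1).false
  have hFg : ∀ᵐ x, HasDerivAt F (g x) x := by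
    filter_upwards [LocallyIntegrable.ae_hasDerivAt_integral hgi.locallyIntegrable] with x hx using hx 0
  have hFzero : ∀ x y, 0 < x → x ≤ y → F y = 0 → x ^ (r - q) * F x ^ q = 0 := by
    intro x y hx hxy hy
    rw [le_antisymm ((hFmono hxy).trans hy.le) (hF0 x hx.le), Real.zero_rpow (by linarith),
      mul_zero]
  have hint : IntegrableOn (fun x => x ^ (r - q) * F x ^ q) (Ioi 0) := by
    rw [← Ioc_union_Ioi_eq_Ioi ha.le]
    refine IntegrableOn.union ?_ ?_
    · exact (integrableOn_zero (ε' := ℝ)).congr_fun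
        (fun x hx => (hFzero x a hx.1 hx.2 hFa).symm) measurableSet_Ioc
    · have hdom : IntegrableOn (fun x : ℝ => x ^ (r - q) * (∫ t, g t) ^ q) (Ioi a) :=
        (integrableOn_Ioi_rpow_of_lt (by linarith) ha).mul_const _
      refine Integrable.mono' hdom ?_ ?_
      · exact ((measurable_id.pow_const _).mul
          (hFlip.continuous.measurable.pow_const q)).aestronglyMeasurable
      · refine (ae_restrict_iff' measurableSet_Ioi).2 (.of_forall fun x hx => ?_)
        have hx0 : 0 < x := ha.trans hx
        have hFx := hF0 x hx0.le
        rw [Real.norm_of_nonneg (by positivity)]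
        refine mul_le_mul_of_nonneg_left (Real.rpow_le_rpow hFx ?_ (by linarith)) (by positivity)
        rw [hFdef]
        simp only
        rw [intervalIntegral.integral_of_le hx0.le]
        exact setIntegral_le_integral hgi (.of_forall hg)
  refine ⟨hint, ?_⟩
  set J := ∫ x in Ioi 0, x ^ (r - q) * F x ^ q with hJdef
  have hL := integral_blissDensity_pos hr hrq
  have hJ0 : 0 ≤ J := setIntegral_nonneg measurableSet_Ioi fun x hx =>
    mul_nonneg (Real.rpow_nonneg (le_of_lt hx) _) (Real.rpow_nonneg (hF0 x (le_of_lt hx)) _)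
  rcases hJ0.eq_or_lt with hJ | hJ
  · rw [← hJ, Real.zero_rpow (by positivity), mul_zero, mul_zero]
    exact setIntegral_nonneg measurableSet_Ioi fun x _ => Real.rpow_nonneg (hg x) p
  have hbdd : BddAbove {x | F x = 0} := by
    by_contra hn
    rw [not_bddAbove_iff] at hn
    refine hJ.ne' (setIntegral_eq_zero_of_forall_eq_zero fun x hx => ?_)
    obtain ⟨y, hy, hxy⟩ := hn x
    exact hFzero x y hx hxy.le hy
  set x₁ := sSup {x | F x = 0} with hx₁def
  have hax₁ : a ≤ x₁ := le_csSup hbdd hFa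
  have hFx₁ : F x₁ = 0 :=
    (isClosed_eq hFlip.continuous continuous_const).csSup_mem ⟨a, hFa⟩ hbdd
  have hFpos : ∀ x, x₁ < x → 0 < F x := fun x hx =>
    (hF0 x (ha.le.trans (hax₁.trans hx.le))).lt_of_ne'
      fun h => hx.not_ge (le_csSup hbdd h)
  have hJx₁ : J = ∫ x in Ioi x₁, x ^ (r - q) * F x ^ q :=
    setIntegral_eq_of_subset_of_forall_sdiff_eq_zero measurableSet_Ioi
      (Ioi_subset_Ioi (ha.le.trans hax₁)) fun x hx =>
        hFzero x x₁ hx.1 (not_lt.1 hx.2) hFx₁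
  have key := bliss_integral_pos hp hr hq (ha.trans_le hax₁) hFlip hFmono hFx₁ hFpos hFg hg
    hgpi.integrableOn (hint.mono_set (Ioi_subset_Ioi (ha.le.trans hax₁)))
  rw [← hJx₁] at key
  refine le_of_eq_of_le ?_ key
  have hJr : J ^ (1 / (r + 1)) * J ^ (r / (r + 1)) = J := by
    rw [← Real.rpow_add hJ, ← add_div, add_comm, div_self (by positivity), Real.rpow_one]
  rw [Real.div_rpow hL.le hJ.le, mul_div_assoc', div_mul_eq_mul_div, eq_div_iff (by positivity)]
  linear_combination (p - 1) * (r + 1) *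
    (∫ t in Ioi (0 : ℝ), blissDensity r q t) ^ (r / (r + 1)) * hJr

/-- The sharp constant in Bliss' inequality. -/
noncomputable def blissConst (p q r : ℝ) : ℝ :=
  (∫ t in Ioi (0 : ℝ), blissDensity r q t) ^ (1 / q) *
    (∫ t in Ioi (0 : ℝ), (1 + t ^ r) ^ (-(q / r))) ^ (-(1 / p))

theorem bliss_integral_rpow_le {p q r J G : ℝ} (hp : 1 < p) (hr : 0 < r) (hq : q = p * (r + 1))
    (hJ : 0 ≤ J)
    (h : (p - 1) * (r + 1) * ((∫ t in Ioi (0 : ℝ), blissDensity r q t) ^ (r / (r + 1)) *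
      J ^ (1 / (r + 1))) ≤ G) :
    J ^ (1 / q) ≤ blissConst p q r * G ^ (1 / p) := by
  have hrq : r + 1 < q := by nlinarith
  have hL := integral_blissDensity_pos hr hrq
  rw [blissConst, integral_one_add_rpow_rpow_eq hr hrq]
  set L := ∫ t in Ioi (0 : ℝ), blissDensity r q t
  have hp0 : 0 < p := by linarith
  have hA : 0 < (p - 1) * (r + 1) := mul_pos (by linarith) (by linarith)
  have hqr : q - r - 1 = (p - 1) * (r + 1) := by rw [hq]; ring
  rw [hqr]
  generalize (p - 1) * (r + 1) = A at *
  clear_value L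
  have h1 : A ^ (1 / p) * (L ^ (r / q) * J ^ (1 / q)) ≤ G ^ (1 / p) := by
    refine le_trans (le_of_eq ?_) (Real.rpow_le_rpow (by positivity) h (by positivity))
    rw [Real.mul_rpow hA.le (by positivity), Real.mul_rpow (by positivity) (by positivity),
      ← Real.rpow_mul hL.le, ← Real.rpow_mul hJ]
    congr 3 <;> · rw [hq]; field_simp
  have h2 : L ^ (1 / q) * (A * L) ^ (-(1 / p)) * (A ^ (1 / p) * (L ^ (r / q) * J ^ (1 / q))) =
      J ^ (1 / q) := by
    have e : L ^ (1 / q) * L ^ (r / q) = L ^ (1 / p) := by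
      rw [← Real.rpow_add hL]; congr 1; rw [hq]; field_simp; ring
    rw [Real.mul_rpow hA.le hL.le, Real.rpow_neg hA.le, Real.rpow_neg hL.le, ← e]
    field_simp
  rw [← h2]
  gcongr

theorem lintegral_bliss_le_of_bounded {p q r a b M : ℝ} {g : ℝ → ℝ} (hp : 1 < p) (hr : 0 < r)
    (hq : q = p * (r + 1)) (ha : 0 < a) (hgm : Measurable g) (hg : ∀ x, 0 ≤ g x)
    (hgM : ∀ x, g x ≤ M) (hgab : ∀ x ∉ Ioc a b, g x = 0) :
    (∫⁻ t in Ioi (0 : ℝ), (ENNReal.ofReal t ^ (r / q - 1) *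
        ∫⁻ s in Ioo 0 t, ENNReal.ofReal (g s)) ^ q) ^ (1 / q) ≤
      ENNReal.ofReal (blissConst p q r) *
        (∫⁻ t in Ioi (0 : ℝ), ENNReal.ofReal (g t) ^ p) ^ (1 / p) := by
  have hp0 : 0 < p := by linarith
  have hq0 : 0 < q := by rw [hq]; positivity
  obtain ⟨hint, hle⟩ := bliss_integral hp hr hq ha hgm hg hgM hgab
  have hgpi := integrable_rpow_of_le_of_eq_zero (by linarith : 0 < p) hgm hg hgM hgab
  have hgi : Integrable g := by
    simpa using integrable_rpow_of_le_of_eq_zero one_pos hgm hg hgM hgab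
  have hF0 : ∀ t, 0 ≤ t → 0 ≤ ∫ s in (0 : ℝ)..t, g s := fun t ht =>
    intervalIntegral.integral_nonneg ht fun s _ => hg s
  have hh0 : ∀ t ∈ Ioi (0 : ℝ), 0 ≤ t ^ (r - q) * (∫ s in (0 : ℝ)..t, g s) ^ q := fun t ht =>
    mul_nonneg (Real.rpow_nonneg (le_of_lt ht) _) (Real.rpow_nonneg (hF0 t (le_of_lt ht)) _)
  have hJ0 := setIntegral_nonneg (μ := volume) measurableSet_Ioi hh0
  have hG0 : 0 ≤ ∫ t in Ioi 0, g t ^ p :=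
    setIntegral_nonneg measurableSet_Ioi fun x _ => Real.rpow_nonneg (hg x) p
  have h1 : ∫⁻ t in Ioi (0 : ℝ), (ENNReal.ofReal t ^ (r / q - 1) *
        ∫⁻ s in Ioo 0 t, ENNReal.ofReal (g s)) ^ q =
      ENNReal.ofReal (∫ t in Ioi 0, t ^ (r - q) * (∫ s in (0 : ℝ)..t, g s) ^ q) := by
    rw [ofReal_integral_eq_lintegral_ofReal hint
      ((ae_restrict_iff' measurableSet_Ioi).2 (.of_forall hh0))]
    refine setLIntegral_congr_fun measurableSet_Ioi fun t ht => ?_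
    have ht0 : 0 < t := ht
    rw [← setLIntegral_congr Ioo_ae_eq_Ioc.symm, ENNReal.mul_rpow_of_nonneg _ _ hq0.le,
      ← ENNReal.rpow_mul, ENNReal.ofReal_rpow_of_pos ht0,
      ← ofReal_integral_eq_lintegral_ofReal hgi.integrableOn (.of_forall hg),
      ← intervalIntegral.integral_of_le ht0.le,
      ENNReal.ofReal_rpow_of_nonneg (hF0 t ht0.le) hq0.le,
      ← ENNReal.ofReal_mul (Real.rpow_nonneg ht0.le _)]
    congr 4
    field_simp
  have h2 : ∫⁻ t in Ioi (0 : ℝ), ENNReal.ofReal (g t) ^ p =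
      ENNReal.ofReal (∫ t in Ioi 0, g t ^ p) := by
    rw [ofReal_integral_eq_lintegral_ofReal hgpi.integrableOn
      (.of_forall fun t => Real.rpow_nonneg (hg t) p)]
    exact lintegral_congr fun t => ENNReal.ofReal_rpow_of_nonneg (hg t) hp0.le
  rw [h1, h2, ENNReal.ofReal_rpow_of_nonneg hJ0 (by positivity),
    ENNReal.ofReal_rpow_of_nonneg hG0 (by positivity), ← ENNReal.ofReal_mul']
  · exact ENNReal.ofReal_le_ofReal (bliss_integral_rpow_le hp hr hq hJ0 hle)
  · positivity

/-- **Bliss' inequality** with the sharp constant. -/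
theorem lintegral_bliss_le {p q r : ℝ} {g : ℝ → ℝ≥0∞} (hp : 1 < p) (hr : 0 < r)
    (hq : q = p * (r + 1)) (hg : Measurable g) :
    (∫⁻ t in Ioi (0 : ℝ), (ENNReal.ofReal t ^ (r / q - 1) * ∫⁻ s in Ioo 0 t, g s) ^ q) ^ (1 / q) ≤
      ENNReal.ofReal (blissConst p q r) * (∫⁻ t in Ioi (0 : ℝ), g t ^ p) ^ (1 / p) := by
  have hp0 : 0 < p := by linarith
  have hq0 : 0 < q := by rw [hq]; positivity
  set u : ℕ → ℝ → ℝ≥0∞ := fun n =>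
    (Ioc (1 / ((n : ℝ) + 1)) (n + 1)).indicator fun s => min (g s) n with hu
  have hum : ∀ n, Measurable (u n) := fun n =>
    (hg.min measurable_const).indicator measurableSet_Ioc
  have humono : Monotone u := by
    intro n k hnk s
    have hnk' : (n : ℝ) ≤ k := by exact_mod_cast hnk
    refine (indicator_le_indicator_of_subset (Ioc_subset_Ioc ?_ (by linarith))
      (fun _ => zero_le) s).trans (indicator_le_indicator (min_le_min_left _ ?_))
    · exact one_div_le_one_div_of_le (by positivity) (by linarith)
    · exact_mod_cast hnk
  have hug : ∀ n s, u n s ≤ g s := fun n s =>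
    (indicator_le_self _ _ s).trans (min_le_left _ _)
  have husup : ∀ s, 0 < s → ⨆ n, u n s = g s := by
    intro s hs
    refine le_antisymm (iSup_le fun n => hug n s) (le_of_forall_lt fun c hc => ?_)
    obtain ⟨n₁, hn₁⟩ := exists_nat_one_div_lt hs
    obtain ⟨n₂, hn₂⟩ := exists_nat_ge s
    obtain ⟨n₃, hn₃⟩ := ENNReal.exists_nat_gt (hc.trans_le le_top).ne
    set n := max n₁ (max n₂ n₃)
    have hl₁ : (n₁ : ℝ) ≤ n := by exact_mod_cast le_max_left _ _
    have hl₂ : (n₂ : ℝ) ≤ n := by exact_mod_cast (le_max_left n₂ n₃).trans (le_max_right _ _)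
    have hl₃ : (n₃ : ℝ≥0∞) ≤ n := by exact_mod_cast (le_max_right n₂ n₃).trans (le_max_right _ _)
    refine lt_of_lt_of_le ?_ (le_iSup (fun n => u n s) n)
    rw [hu]
    simp only
    rw [indicator_of_mem]
    · exact lt_min hc (hn₃.trans_le hl₃)
    · exact ⟨(one_div_le_one_div_of_le (by positivity) (by linarith)).trans_lt hn₁, by linarith⟩
  have hinner : ∀ t, ∫⁻ s in Ioo 0 t, g s = ⨆ n, ∫⁻ s in Ioo 0 t, u n s := fun t => by
    rw [← lintegral_iSup hum humono]
    exact setLIntegral_congr_fun measurableSet_Ioo fun s hs => (husup s hs.1).symm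
  have hmeas : ∀ f : ℝ → ℝ≥0∞, Measurable f → Measurable fun t => ∫⁻ s in Ioo 0 t, f s := by
    intro f hf
    have hmono : Monotone fun t => ∫⁻ s in Ioo 0 t, f s := fun t t' h =>
      lintegral_mono_set (Ioo_subset_Ioo_right h)
    exact hmono.measurable
  have houter : ∫⁻ t in Ioi (0 : ℝ), (ENNReal.ofReal t ^ (r / q - 1) * ∫⁻ s in Ioo 0 t, g s) ^ q =
      ⨆ n, ∫⁻ t in Ioi (0 : ℝ), (ENNReal.ofReal t ^ (r / q - 1) * ∫⁻ s in Ioo 0 t, u n s) ^ q := by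
    rw [← lintegral_iSup]
    · refine lintegral_congr fun t => ?_
      rw [hinner, ENNReal.mul_iSup]
      exact (ENNReal.orderIsoRpow q hq0).map_iSup _
    · intro n
      exact ((ENNReal.measurable_ofReal.pow_const _).mul (hmeas _ (hum n))).pow_const q
    · intro n k hnk t
      refine ENNReal.rpow_le_rpow (mul_le_mul_right ?_ _) hq0.le
      exact lintegral_mono (humono hnk)
  rw [houter, ENNReal.rpow_one_div_le_iff hq0]
  refine iSup_le fun n => ?_
  rw [← ENNReal.rpow_one_div_le_iff hq0]
  have hutop : ∀ s, u n s ≤ n := fun s =>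
    (indicator_le_indicator (min_le_right _ _)).trans (indicator_le_self _ (fun _ => (n : ℝ≥0∞)) s)
  have hofReal : ∀ s, ENNReal.ofReal (u n s).toReal = u n s := fun s =>
    ENNReal.ofReal_toReal ((hutop s).trans_lt (ENNReal.natCast_lt_top n)).ne
  have key := lintegral_bliss_le_of_bounded (g := fun s => (u n s).toReal) (M := n)
    (a := 1 / ((n : ℝ) + 1)) (b := n + 1) hp hr hq (by positivity) (hum n).ennreal_toReal
    (fun s => ENNReal.toReal_nonneg)
    (fun s => by simpa using ENNReal.toReal_mono (ENNReal.natCast_ne_top n) (hutop s))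
    (fun s hs => by simp only [hu, indicator_of_notMem hs, ENNReal.toReal_zero])
  simp only [hofReal] at key
  refine key.trans (mul_le_mul_right (ENNReal.rpow_le_rpow ?_ (by positivity)) _)
  exact lintegral_mono fun t => ENNReal.rpow_le_rpow (hug n t) hp0.le

/-- The kernel of a Hardy operator whose balls are sublevel sets of `Φ`. -/
noncomputable def hardyKernel {X : Type*} (s : ℝ) (Φ : X → ℝ) (x y : X) : ℝ≥0∞ :=
  ENNReal.ofReal (Φ x) ^ s * {z | Φ z < Φ x}.indicator 1 y

theorem measurable_hardyKernel {X : Type*} [MeasurableSpace X] (s : ℝ) {Φ : X → ℝ}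
    (hΦ : Measurable Φ) : Measurable (Function.uncurry (hardyKernel s Φ)) := by
  have h : Function.uncurry (hardyKernel s Φ) = fun z : X × X =>
      ENNReal.ofReal (Φ z.1) ^ s * {z : X × X | Φ z.2 < Φ z.1}.indicator 1 z := rfl
  rw [h]
  exact (hΦ.comp measurable_fst).ennreal_ofReal.pow_const _ |>.mul
    (measurable_one.indicator (measurableSet_lt (hΦ.comp measurable_snd) (hΦ.comp measurable_fst)))

theorem lintegral_hardyKernel_mul {X : Type*} [MeasurableSpace X] (μ : Measure X) (s : ℝ)
    {Φ : X → ℝ} (hΦ : Measurable Φ) {f : X → ℝ≥0∞} (hf : Measurable f) (x : X) :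
    ∫⁻ y, hardyKernel s Φ x y * f y ∂μ =
      ENNReal.ofReal (Φ x) ^ s * ∫⁻ y in {y | Φ y < Φ x}, f y ∂μ := by
  have hs : MeasurableSet {y | Φ y < Φ x} := measurableSet_lt hΦ measurable_const
  rw [← lintegral_indicator hs, ← lintegral_const_mul _ (hf.indicator hs)]
  refine lintegral_congr fun y => ?_
  by_cases hy : Φ y < Φ x <;> simp [hardyKernel, indicator, hy]

theorem lintegral_hardyKernel_le {X : Type*} [MeasurableSpace X] (μ : Measure X) [SFinite μ]
    {Φ : X → ℝ} (hΦ : Measurable Φ) (hmap : μ.map Φ = volume.restrict (Ioi 0)) {p q r : ℝ}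
    (hp : 1 < p) (hr : 0 < r) (hq : q = p * (r + 1)) {f : X → ℝ≥0∞} (hf : Measurable f) :
    (∫⁻ x, (∫⁻ y, hardyKernel (r / q - 1) Φ x y * f y ∂μ) ^ q ∂μ) ^ (1 / q) ≤
      ENNReal.ofReal (blissConst p q r) * (∫⁻ x, f x ^ p ∂μ) ^ (1 / p) := by
  set ν := (μ.withDensity f).map Φ with hν
  have hνac : ν ≪ volume.restrict (Ioi 0) :=
    hmap ▸ (withDensity_absolutelyContinuous μ f).map hΦ
  set g := ν.rnDeriv (volume.restrict (Ioi 0)) with hgdef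
  have hgm : Measurable g := Measure.measurable_rnDeriv _ _
  have hg : (volume.restrict (Ioi 0)).withDensity g = ν := Measure.withDensity_rnDeriv_eq _ _ hνac
  have hinner : ∀ t, ∫⁻ s in Ioo 0 t, g s = ∫⁻ y in {y | Φ y < t}, f y ∂μ := by
    intro t
    have h1 : ν (Iio t) = ∫⁻ y in {y | Φ y < t}, f y ∂μ := by
      rw [hν, Measure.map_apply hΦ measurableSet_Iio,
        withDensity_apply _ (hΦ measurableSet_Iio)]
      rfl
    rw [← h1, ← hg, withDensity_apply _ measurableSet_Iio, Measure.restrict_restrict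
      measurableSet_Iio, inter_comm, Ioi_inter_Iio]
  have hmono : Monotone fun t => ∫⁻ s in Ioo 0 t, g s := fun t t' h =>
    lintegral_mono_set (Ioo_subset_Ioo_right h)
  have hleft : ∫⁻ x, (∫⁻ y, hardyKernel (r / q - 1) Φ x y * f y ∂μ) ^ q ∂μ =
      ∫⁻ t in Ioi (0 : ℝ), (ENNReal.ofReal t ^ (r / q - 1) * ∫⁻ s in Ioo 0 t, g s) ^ q := by
    have hm : Measurable fun t : ℝ =>
        (ENNReal.ofReal t ^ (r / q - 1) * ∫⁻ s in Ioo 0 t, g s) ^ q :=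
      ((ENNReal.measurable_ofReal.pow_const _).mul hmono.measurable).pow_const q
    rw [← hmap, lintegral_map hm hΦ]
    simp only [hinner, lintegral_hardyKernel_mul μ _ hΦ hf]
  rw [hleft]
  refine (lintegral_bliss_le hp hr hq hgm).trans (mul_le_mul_right ?_ _)
  have hc := Real.HolderConjugate.conjExponent hp
  refine lintegral_rpow_le_of_forall_lintegral_mul_le _ hc hgm _ fun ψ hψ => ?_
  calc ∫⁻ t in Ioi 0, g t * ψ t = ∫⁻ t, ψ t ∂ν := by
        rw [← hg, lintegral_withDensity_eq_lintegral_mul _ hgm hψ]; rfl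
    _ = ∫⁻ x, (f * (ψ ∘ Φ)) x ∂μ := by
        rw [hν, lintegral_map hψ hΦ]
        exact lintegral_withDensity_eq_lintegral_mul _ hf (hψ.comp hΦ)
    _ ≤ (∫⁻ x, f x ^ p ∂μ) ^ (1 / p) *
        (∫⁻ x, (ψ ∘ Φ) x ^ p.conjExponent ∂μ) ^ (1 / p.conjExponent) :=
      ENNReal.lintegral_mul_le_Lp_mul_Lq μ hc hf.aemeasurable (hψ.comp hΦ).aemeasurable
    _ = _ := by
        rw [← hmap, lintegral_map (hψ.pow_const _) hΦ]
        rfl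

/-- The volume of the centered ball whose boundary contains `x`. -/
noncomputable def ballVolume {n : ℕ} (x : EuclideanSpace ℝ (Fin n)) : ℝ :=
  (volume (Metric.ball (0 : EuclideanSpace ℝ (Fin n)) ‖x‖)).toReal

theorem ofReal_ballVolume {n : ℕ} (x : EuclideanSpace ℝ (Fin n)) :
    ENNReal.ofReal (ballVolume x) =
      volume (Metric.ball (0 : EuclideanSpace ℝ (Fin n)) ‖x‖) :=
  ENNReal.ofReal_toReal measure_ball_lt_top.ne

theorem exists_volume_ball_eq {n : ℕ} (hn : n ≠ 0) : ∃ v : ℝ, 0 < v ∧ ∀ R : ℝ, 0 ≤ R →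
    volume (Metric.ball (0 : EuclideanSpace ℝ (Fin n)) R) = ENNReal.ofReal (R ^ n * v) := by
  have : Nonempty (Fin n) := ⟨⟨0, Nat.pos_of_ne_zero hn⟩⟩
  refine ⟨(volume (Metric.ball (0 : EuclideanSpace ℝ (Fin n)) 1)).toReal,
    ENNReal.toReal_pos (Metric.measure_ball_pos _ _ one_pos).ne' measure_ball_lt_top.ne,
    fun R hR => ?_⟩
  rw [Measure.addHaar_ball _ _ hR, finrank_euclideanSpace_fin, ENNReal.ofReal_mul (by positivity),
    ENNReal.ofReal_toReal measure_ball_lt_top.ne]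

theorem ballVolume_eq {n : ℕ} {v : ℝ} (hv : 0 < v) (h : ∀ R : ℝ, 0 ≤ R →
    volume (Metric.ball (0 : EuclideanSpace ℝ (Fin n)) R) = ENNReal.ofReal (R ^ n * v))
    (x : EuclideanSpace ℝ (Fin n)) : ballVolume x = ‖x‖ ^ n * v := by
  rw [ballVolume, h _ (norm_nonneg x), ENNReal.toReal_ofReal (by positivity)]

theorem measurable_ballVolume {n : ℕ} (hn : n ≠ 0) :
    Measurable (ballVolume : EuclideanSpace ℝ (Fin n) → ℝ) := by
  obtain ⟨v, hv, h⟩ := exists_volume_ball_eq hn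
  rw [funext (ballVolume_eq hv h)]
  fun_prop

theorem ballVolume_lt_ballVolume_iff {n : ℕ} (hn : n ≠ 0) {x y : EuclideanSpace ℝ (Fin n)} :
    ballVolume y < ballVolume x ↔ ‖y‖ < ‖x‖ := by
  obtain ⟨v, hv, h⟩ := exists_volume_ball_eq hn
  rw [ballVolume_eq hv h, ballVolume_eq hv h, mul_lt_mul_iff_left₀ hv,
    pow_lt_pow_iff_left₀ (norm_nonneg y) (norm_nonneg x) hn]

theorem map_ballVolume {n : ℕ} (hn : n ≠ 0) :
    (volume : Measure (EuclideanSpace ℝ (Fin n))).map ballVolume = volume.restrict (Ioi 0) := by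
  obtain ⟨v, hv, h⟩ := exists_volume_ball_eq hn
  have h1 : ∀ t, (volume : Measure (EuclideanSpace ℝ (Fin n))).map ballVolume (Iio t) =
      ENNReal.ofReal t := by
    intro t
    rw [Measure.map_apply (measurable_ballVolume hn) measurableSet_Iio]
    rcases le_or_gt t 0 with ht | ht
    · rw [ENNReal.ofReal_of_nonpos ht]
      refine measure_mono_null (fun x hx => ?_) measure_empty
      exact absurd (lt_of_lt_of_le hx ht) (not_lt.2 ENNReal.toReal_nonneg)
    · have hR : ((t / v) ^ (1 / (n : ℝ))) ^ n * v = t := by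
        rw [one_div, Real.rpow_inv_natCast_pow (by positivity) hn, div_mul_cancel₀ _ hv.ne']
      have hset : ballVolume ⁻¹' Iio t =
          Metric.ball (0 : EuclideanSpace ℝ (Fin n)) ((t / v) ^ (1 / (n : ℝ))) := by
        ext x
        rw [mem_preimage, mem_Iio, mem_ball_zero_iff, ballVolume_eq hv h]
        nth_rewrite 1 [← hR]
        rw [mul_lt_mul_iff_left₀ hv, pow_lt_pow_iff_left₀ (norm_nonneg x) (by positivity) hn]
      rw [hset, h _ (by positivity), hR]
  have h2 : ∀ t, volume.restrict (Ioi 0) (Iio t) = ENNReal.ofReal t := by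
    intro t
    rw [Measure.restrict_apply measurableSet_Iio, inter_comm, Ioi_inter_Iio, Real.volume_Ioo,
      sub_zero]
  refine (Measure.ext_of_Ico _ _ fun a b hab => ?_).symm
  have hdiff : Ico a b = Iio b \ Iio a := by
    ext x
    simp
  rw [hdiff, measure_sdiff (Iio_subset_Iio hab.le) measurableSet_Iio.nullMeasurableSet
    (by simp [h2]), measure_sdiff (Iio_subset_Iio hab.le) measurableSet_Iio.nullMeasurableSet
    (by simp [h1]), h1, h1, h2, h2]

/-- The extremal function of Bliss' inequality. -/
noncomputable def blissExtremal (r t : ℝ) : ℝ := (1 + t ^ r) ^ (-((r + 1) / r))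

theorem measurable_blissExtremal (r : ℝ) : Measurable (blissExtremal r) := by
  unfold blissExtremal
  fun_prop

theorem blissExtremal_nonneg {r t : ℝ} (ht : 0 ≤ t) : 0 ≤ blissExtremal r t := by
  unfold blissExtremal
  positivity

theorem integral_blissExtremal {r t : ℝ} (hr : 0 < r) (ht : 0 < t) :
    ∫ s in (0 : ℝ)..t, blissExtremal r s = t * (1 + t ^ r) ^ (-(1 / r)) := by
  have hcont : ContinuousOn (blissExtremal r) (Icc 0 t) :=
    (continuous_one_add_rpow_rpow hr _).mono Icc_subset_Ici_self
  rw [intervalIntegral.integral_eq_sub_of_hasDerivAt_of_le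
    (f := fun s => s * (1 + s ^ r) ^ (-(1 / r))) ht.le
    (continuousOn_id.mul ((continuous_one_add_rpow_rpow hr _).mono Icc_subset_Ici_self)) (fun s hs => ?_)
    (hcont.intervalIntegrable_of_Icc ht.le)]
  · simp
  · have hs0 : 0 < s := hs.1
    convert! (hasDerivAt_id s).mul (hasDerivAt_one_add_rpow_rpow (r := r) (-(1 / r)) hs0) using 1
    have hD : 0 < 1 + s ^ r := by positivity
    have e1 : -((r + 1) / r) = -(1 / r) - 1 := by field_simp; ring
    have e2 : (1 + s ^ r) ^ (-(1 / r)) = (1 + s ^ r) ^ (-(1 / r) - 1) * (1 + s ^ r) := by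
      rw [← Real.rpow_add_one hD.ne']; congr 1; ring
    have e3 : s ^ r = s ^ (r - 1) * s := by rw [← Real.rpow_add_one hs0.ne']; congr 1; ring
    rw [blissExtremal, e1, e2]
    generalize (1 + s ^ r) ^ (-(1 / r) - 1) = D
    simp only [id]
    rw [e3]
    field_simp
    ring

theorem setLIntegral_blissExtremal {r t : ℝ} (hr : 0 < r) (ht : 0 < t) :
    ∫⁻ s in Ioo 0 t, ENNReal.ofReal (blissExtremal r s) =
      ENNReal.ofReal (t * (1 + t ^ r) ^ (-(1 / r))) := by
  rw [← integral_blissExtremal hr ht, intervalIntegral.integral_of_le ht.le,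
    setLIntegral_congr Ioo_ae_eq_Ioc, ofReal_integral_eq_lintegral_ofReal]
  · exact ((continuous_one_add_rpow_rpow hr _).mono Icc_subset_Ici_self).integrableOn_Icc.mono_set
      Ioc_subset_Icc_self
  · exact (ae_restrict_iff' measurableSet_Ioc).2
      (.of_forall fun s hs => blissExtremal_nonneg hs.1.le)

theorem lintegral_blissExtremal_rpow {p q r : ℝ} (hp : 1 < p) (hr : 0 < r)
    (hq : q = p * (r + 1)) :
    ∫⁻ t in Ioi (0 : ℝ), ENNReal.ofReal (blissExtremal r t) ^ p =
      ENNReal.ofReal (∫ t in Ioi (0 : ℝ), (1 + t ^ r) ^ (-(q / r))) := by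
  rw [ofReal_integral_eq_lintegral_ofReal
    (integrableOn_one_add_rpow_rpow hr (by nlinarith)) ((ae_restrict_iff' measurableSet_Ioi).2
      (.of_forall fun t ht => by have : 0 < t := ht; positivity))]
  refine setLIntegral_congr_fun measurableSet_Ioi fun t ht => ?_
  have ht0 : 0 < t := ht
  rw [ENNReal.ofReal_rpow_of_nonneg (blissExtremal_nonneg ht0.le) (by linarith), blissExtremal,
    ← Real.rpow_mul (by positivity)]
  congr 2
  rw [hq]
  ring

theorem lintegral_blissExtremal_energy {p q r : ℝ} (hp : 1 < p) (hr : 0 < r)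
    (hq : q = p * (r + 1)) :
    ∫⁻ t in Ioi (0 : ℝ), (ENNReal.ofReal t ^ (r / q - 1) *
        ∫⁻ s in Ioo 0 t, ENNReal.ofReal (blissExtremal r s)) ^ q =
      ENNReal.ofReal (∫ t in Ioi (0 : ℝ), blissDensity r q t) := by
  have hq0 : 0 < q := by rw [hq]; positivity
  rw [ofReal_integral_eq_lintegral_ofReal
    (integrableOn_blissDensity hr (by nlinarith)) ((ae_restrict_iff' measurableSet_Ioi).2
      (.of_forall fun t ht => (blissDensity_pos ht).le))]
  refine setLIntegral_congr_fun measurableSet_Ioi fun t ht => ?_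
  have ht0 : 0 < t := ht
  have hD : 0 < 1 + t ^ r := by positivity
  rw [setLIntegral_blissExtremal hr ht0, ENNReal.ofReal_rpow_of_pos ht0,
    ← ENNReal.ofReal_mul (by positivity), ENNReal.ofReal_rpow_of_nonneg (by positivity) hq0.le,
    ← mul_assoc, ← Real.rpow_add_one ht0.ne', Real.mul_rpow (by positivity) (by positivity),
    ← Real.rpow_mul ht0.le, ← Real.rpow_mul hD.le, blissDensity]
  congr 3
  · field_simp
    ring
  · ring

theorem lintegral_pi_prod : ∀ {m : ℕ} {X : Fin m → Type*} [∀ i, MeasurableSpace (X i)]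
    (μ : ∀ i, Measure (X i)) [∀ i, SigmaFinite (μ i)] {f : ∀ i, X i → ℝ≥0∞}
    (_ : ∀ i, Measurable (f i)),
    ∫⁻ x, ∏ i, f i (x i) ∂Measure.pi μ = ∏ i, ∫⁻ x, f i x ∂μ i := by
  intro m
  induction m with
  | zero =>
    intro X _ μ _ f _
    simp [Measure.pi_of_empty μ]
  | succ m ih =>
    intro X _ μ _ f hf
    let e := MeasurableEquiv.piFinSuccAbove X 0
    have hpull : ∫⁻ z, ∏ i, f i (e.symm z i) ∂((μ 0).prod (Measure.pi fun j : Fin m => μ j.succ)) =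
        ∫⁻ x, ∏ i, f i (x i) ∂Measure.pi μ :=
      ((measurePreserving_piFinSuccAbove μ 0).symm e).lintegral_comp_emb
        e.symm.measurableEmbedding fun x => ∏ i, f i (x i)
    have h1 : ∀ z : X 0 × (∀ j : Fin m, X j.succ), e.symm z 0 = z.1 := fun z => rfl
    have h2 : ∀ (z : X 0 × (∀ j : Fin m, X j.succ)) (j : Fin m), e.symm z j.succ = z.2 j :=
      fun z j => rfl
    rw [← hpull]
    simp only [Fin.prod_univ_succ, h1, h2]
    rw [← ih (fun j : Fin m => μ j.succ) (fun j => hf j.succ)]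
    refine lintegral_prod_mul (μ := μ 0) (ν := Measure.pi fun j : Fin m => μ j.succ) (f := f 0)
      (g := fun z => ∏ j : Fin m, f j.succ (z j)) (hf 0).aemeasurable
      (Measurable.aemeasurable (Finset.measurable_prod _ fun j _ => ?_))
    exact (hf j.succ).comp (measurable_pi_apply j)

theorem prodFracHardy_eq_lintegral_hardyKernel {m : ℕ} {n : Fin m → ℕ} (hn : ∀ i, 1 ≤ n i)
    {β : Fin m → ℝ} {s : ℝ} (hs : ∀ i, β i / n i - 1 = s)
    {f : (∀ i, EuclideanSpace ℝ (Fin (n i))) → ℝ≥0∞} (hf : Measurable f)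
    (x : ∀ i, EuclideanSpace ℝ (Fin (n i))) :
    prodFracHardy m n β f x = ∫⁻ y, (∏ i, hardyKernel s ballVolume (x i) (y i)) * f y := by
  have hset : MeasurableSet {y : ∀ i, EuclideanSpace ℝ (Fin (n i)) | ∀ i, ‖y i‖ < ‖x i‖} := by
    simp only [Set.ofPred_forall]
    exact MeasurableSet.iInter fun i =>
      measurableSet_lt (measurable_pi_apply i).norm measurable_const
  rw [prodFracHardy, ← lintegral_indicator hset, ← lintegral_const_mul _ (hf.indicator hset)]
  refine lintegral_congr fun y => ?_
  have hlt : ∀ i, ballVolume (y i) < ballVolume (x i) ↔ ‖y i‖ < ‖x i‖ := fun i =>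
    ballVolume_lt_ballVolume_iff (Nat.one_le_iff_ne_zero.1 (hn i))
  simp only [hardyKernel, Finset.prod_mul_distrib, ofReal_ballVolume, hs, mul_assoc]
  congr 1
  by_cases hy : ∀ i, ‖y i‖ < ‖x i‖
  · have : ∀ i, y i ∈ {z | ballVolume z < ballVolume (x i)} := fun i => (hlt i).2 (hy i)
    simp [indicator, hy, hlt]
  · obtain ⟨i, hi⟩ := not_forall.1 hy
    rw [indicator_of_notMem (by exact hy), Finset.prod_eq_zero (Finset.mem_univ i), zero_mul]
    exact indicator_of_notMem (s := {z | ballVolume z < ballVolume (x i)})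
      (fun h => hi ((hlt i).1 h)) 1

theorem blissConst_eq {p q r b : ℝ} {n : ℕ} (hp : 1 < p) (hr : 0 < r) (hq : q = p * (r + 1))
    (hn : 1 ≤ n) (hb : b / n = r / q) :
    ((p / (p - 1)) / q) ^ (1 / q) * ((n / (q * b)) *
      betaFn (n / (q * b)) (n / ((q / (q - 1)) * b))) ^ (-b / n) = blissConst p q r := by
  have hrq : r + 1 < q := by nlinarith
  have hq0 : 0 < q := by linarith
  have hn0 : (0 : ℝ) < n := by exact_mod_cast hn
  have hb' : b = r / q * n := by rw [← hb]; field_simp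
  have h1 : n / (q * b) = 1 / r := by rw [hb']; field_simp
  have h2 : n / ((q / (q - 1)) * b) = (q - 1) / r := by rw [hb']; field_simp
  have hL := integral_blissDensity_pos hr hrq
  rw [h1, h2, ← integral_one_add_rpow_rpow_eq_betaFn hr, neg_div, hb, blissConst,
    integral_one_add_rpow_rpow_eq hr hrq]
  generalize (∫ t in Ioi (0 : ℝ), blissDensity r q t) = L at *
  have hA : 0 < (p - 1) * (r + 1) := mul_pos (by linarith) (by linarith)
  have h3 : q - r - 1 = (p - 1) * (r + 1) := by rw [hq]; ring
  have h4 : p / (p - 1) / q = ((p - 1) * (r + 1))⁻¹ := by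
    have : p - 1 ≠ 0 := by linarith
    rw [hq]; field_simp
  rw [h3, h4]
  generalize (p - 1) * (r + 1) = A at *
  have h5 : -(r / q) = 1 / q + -(1 / p) := by
    have : 0 < p := by linarith
    rw [hq]; field_simp; ring
  rw [h5, Real.rpow_add (by positivity), Real.inv_rpow hA.le, Real.mul_rpow hA.le hL.le]
  field_simp

theorem setLIntegral_comp_ballVolume {n : ℕ} (hn : n ≠ 0) {g : ℝ → ℝ≥0∞} (hg : Measurable g)
    (t : ℝ) :
    ∫⁻ y in {y : EuclideanSpace ℝ (Fin n) | ballVolume y < t}, g (ballVolume y) =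
      ∫⁻ s in Ioo 0 t, g s := by
  rw [← Ioi_inter_Iio, inter_comm, ← Measure.restrict_restrict measurableSet_Iio,
    ← map_ballVolume hn, setLIntegral_map measurableSet_Iio hg (measurable_ballVolume hn)]
  rfl

/-- Sharp bound for `𝓗_{β₁,…,β_m} : L^p(ℝ^{n₁}×⋯×ℝ^{n_m}) → L^q(ℝ^{n₁}×⋯×ℝ^{n_m})`. -/
theorem prodFracHardy_sharp (m : ℕ) (hm : 1 ≤ m) (n : Fin m → ℕ) (hn : ∀ i, 1 ≤ n i)
    (β : Fin m → ℝ) (p q : ℝ) (hp : 1 < p) (hpq : p < q)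
    (hβ0 : ∀ i, 0 < β i) (hβn : ∀ i, β i < n i)
    (hscal : ∀ i, 1 / q = 1 / p - β i / n i) :
    (∀ f : (∀ i, EuclideanSpace ℝ (Fin (n i))) → ℝ≥0∞, Measurable f →
      (∫⁻ x, prodFracHardy m n β f x ^ q) ^ (1 / q)
        ≤ ENNReal.ofReal (∏ i, ((p / (p - 1)) / q) ^ (1 / q) *
            ((n i / (q * β i)) *
              betaFn (n i / (q * β i)) (n i / ((q / (q - 1)) * β i))) ^ (-(β i) / n i)) *
          (∫⁻ x, f x ^ p) ^ (1 / p)) ∧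
    (∀ C : ℝ≥0∞,
      (∀ f : (∀ i, EuclideanSpace ℝ (Fin (n i))) → ℝ≥0∞, Measurable f →
        (∫⁻ x, prodFracHardy m n β f x ^ q) ^ (1 / q) ≤ C * (∫⁻ x, f x ^ p) ^ (1 / p)) →
      ENNReal.ofReal (∏ i, ((p / (p - 1)) / q) ^ (1 / q) *
          ((n i / (q * β i)) *
            betaFn (n i / (q * β i)) (n i / ((q / (q - 1)) * β i))) ^ (-(β i) / n i)) ≤ C) := by
  have hp0 : 0 < p := by linarith
  have hq0 : 0 < q := by linarith
  obtain ⟨r, hr⟩ : ∃ r, r = q / p - 1 := ⟨_, rfl⟩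
  have hr0 : 0 < r := by
    rw [hr, sub_pos, one_lt_div hp0]
    exact hpq
  have hq : q = p * (r + 1) := by rw [hr]; field_simp; ring
  have hβr : ∀ i, β i / n i = r / q := fun i => by
    have h := hscal i
    rw [hr, sub_div, div_div_cancel_left' hq0.ne', ← one_div]
    linarith
  have hn' : ∀ i, n i ≠ 0 := fun i => Nat.one_le_iff_ne_zero.1 (hn i)
  have hker := fun (f : (∀ i, EuclideanSpace ℝ (Fin (n i))) → ℝ≥0∞) (hf : Measurable f) =>
    prodFracHardy_eq_lintegral_hardyKernel (β := β) hn (s := r / q - 1) (fun i => by rw [hβr i]) hf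
  simp only [blissConst_eq hp hr0 hq (hn _) (hβr _)]
  have hL := integral_blissDensity_pos hr0 (by nlinarith : r + 1 < q)
  have hI : 0 < ∫ t in Ioi (0 : ℝ), (1 + t ^ r) ^ (-(q / r)) := by
    rw [integral_one_add_rpow_rpow_eq hr0 (by nlinarith)]
    exact mul_pos (by nlinarith) hL
  constructor
  · intro f hf
    simp only [hker f hf]
    rw [ENNReal.ofReal_prod_of_nonneg fun i _ => by rw [blissConst]; positivity]
    exact lintegral_pi_kernel_le hp0 hpq (fun _ => volume)
      (fun i => measurable_hardyKernel _ (measurable_ballVolume (hn' i)))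
      (fun i f hf => lintegral_hardyKernel_le volume (measurable_ballVolume (hn' i))
        (map_ballVolume (hn' i)) hp hr0 hq hf) hf
  · intro C hC
    set u : ℝ → ℝ≥0∞ := fun t => ENNReal.ofReal (blissExtremal r t) with hu
    have hum : Measurable u := (measurable_blissExtremal r).ennreal_ofReal
    have huΦ : ∀ i, Measurable fun y : EuclideanSpace ℝ (Fin (n i)) => u (ballVolume y) :=
      fun i => hum.comp (measurable_ballVolume (hn' i))
    have hfm : Measurable fun y : ∀ i, EuclideanSpace ℝ (Fin (n i)) =>
        ∏ i, u (ballVolume (y i)) :=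
      Finset.measurable_prod _ fun i _ => (huΦ i).comp (measurable_pi_apply i)
    have h := hC _ hfm
    have hmono : Monotone fun t => ∫⁻ s in Ioo 0 t, u s := fun t t' h =>
      lintegral_mono_set (Ioo_subset_Ioo_right h)
    have hEm : Measurable fun t : ℝ =>
        (ENNReal.ofReal t ^ (r / q - 1) * ∫⁻ s in Ioo 0 t, u s) ^ q :=
      ((ENNReal.measurable_ofReal.pow_const _).mul hmono.measurable).pow_const q
    have hleft : ∫⁻ x, prodFracHardy m n β (fun y => ∏ i, u (ballVolume (y i))) x ^ q =
        ENNReal.ofReal (∫ t in Ioi (0 : ℝ), blissDensity r q t) ^ m := by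
      have hx : ∀ x, prodFracHardy m n β (fun y => ∏ i, u (ballVolume (y i))) x ^ q =
          ∏ i, (ENNReal.ofReal (ballVolume (x i)) ^ (r / q - 1) *
            ∫⁻ s in Ioo 0 (ballVolume (x i)), u s) ^ q := by
        intro x
        rw [hker _ hfm, ENNReal.prod_rpow_of_nonneg hq0.le]
        simp only [← Finset.prod_mul_distrib]
        have := lintegral_pi_prod (fun i => (volume : Measure (EuclideanSpace ℝ (Fin (n i)))))
          (f := fun i y => hardyKernel (r / q - 1) ballVolume (x i) y * u (ballVolume y))
          fun i => ((measurable_hardyKernel _ (measurable_ballVolume (hn' i))).comp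
            measurable_prodMk_left).mul (huΦ i)
        rw [volume_pi, this]
        congr 1
        refine Finset.prod_congr rfl fun i _ => ?_
        rw [lintegral_hardyKernel_mul _ _ (measurable_ballVolume (hn' i)) (huΦ i),
          setLIntegral_comp_ballVolume (hn' i) hum]
      simp only [hx]
      rw [volume_pi, lintegral_pi_prod (fun i => (volume : Measure (EuclideanSpace ℝ (Fin (n i)))))
        (f := fun i y => (ENNReal.ofReal (ballVolume y) ^ (r / q - 1) *
          ∫⁻ s in Ioo 0 (ballVolume y), u s) ^ q)
        (fun i => hEm.comp (measurable_ballVolume (hn' i)))]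
      rw [Finset.prod_congr rfl fun i _ => ?_, Finset.prod_const, Finset.card_fin]
      rw [← lintegral_blissExtremal_energy hp hr0 hq, ← map_ballVolume (hn' i),
        lintegral_map hEm (measurable_ballVolume (hn' i))]
    have hright : ∫⁻ x : ∀ i, EuclideanSpace ℝ (Fin (n i)), (∏ i, u (ballVolume (x i))) ^ p =
        ENNReal.ofReal (∫ t in Ioi (0 : ℝ), (1 + t ^ r) ^ (-(q / r))) ^ m := by
      simp only [← ENNReal.prod_rpow_of_nonneg hp0.le]
      rw [volume_pi, lintegral_pi_prod (fun i => (volume : Measure (EuclideanSpace ℝ (Fin (n i)))))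
        (f := fun i y => u (ballVolume y) ^ p) (fun i => (huΦ i).pow_const p)]
      rw [Finset.prod_congr rfl fun i _ => ?_, Finset.prod_const, Finset.card_fin]
      rw [← lintegral_blissExtremal_rpow hp hr0 hq, ← map_ballVolume (hn' i),
        lintegral_map (hum.pow_const p) (measurable_ballVolume (hn' i))]
    rw [hleft, hright] at h
    rw [Finset.prod_const, Finset.card_fin, blissConst]
    generalize (∫ t in Ioi (0 : ℝ), blissDensity r q t) = L at *
    generalize (∫ t in Ioi (0 : ℝ), (1 + t ^ r) ^ (-(q / r))) = I at *
    rw [← ENNReal.ofReal_pow hL.le, ← ENNReal.ofReal_pow hI.le,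
      ENNReal.ofReal_rpow_of_pos (by positivity), ENNReal.ofReal_rpow_of_pos (by positivity)] at h
    have hc : (L ^ (1 / q) * I ^ (-(1 / p))) ^ m = (L ^ m) ^ (1 / q) / (I ^ m) ^ (1 / p) := by
      rw [mul_pow, Real.rpow_neg hI.le, inv_pow, ← div_eq_mul_inv]
      simp only [← Real.rpow_natCast, ← Real.rpow_mul hL.le, ← Real.rpow_mul hI.le, mul_comm]
    rw [hc, ENNReal.ofReal_div_of_pos (by positivity)]
    exact ENNReal.div_le_of_le_mul h
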